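/- arXiv:1312.6631 — 4 statements merged into one kernel-verified Lean document; each statement's English description precedes it below -/
import Mathlib

section
/- Let M be an n×n real symmetric positive definite tridiagonal matrix with smallest eigenvalue λ_min and largest eigenvalue λ_max, λ_min < λ_max, and let S = M ⊗ I_n + I_n ⊗ M (Kronecker sum), a matrix of size n². For k, t ∈ {1, …, n²} set j = ⌊(t−1)/n⌋ + 1, i = t − n⌊(t−1)/n⌋, m = ⌊(k−1)/n⌋ + 1, ℓ = k − n⌊(k−1)/n⌋. For ω ∈ ℝ let α(ω) = (√(λ_min² + ω²) + √(λ_max² + ω²))/(λ_max − λ_min) and R(ω) = α(ω) + √(α(ω)² − 1). If i ≠ ℓ and j ≠ m, then |(S⁻¹)_{k,t}| ≤ (1/(2π)) · (64/(λ_max − λ_min)²) · ∫_{−∞}^{∞} (R(ω)²/(R(ω)² − 1)²)² · (1/R(ω))^{|i−ℓ| + |j−m| − 2} dω. -/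
open MeasureTheory Real Matrix

/-- The Kronecker sum `S = M ⊗ Iₙ + Iₙ ⊗ M`, written entrywise with 0-based
indices: for `k, t ∈ Fin (n*n)`, the row grid index is `k % n` and the column
grid index is `k / n` (vec convention stacking columns). -/
noncomputable def kronSum (n : ℕ) (M : Matrix (Fin n) (Fin n) ℝ) :
    Matrix (Fin (n * n)) (Fin (n * n)) ℝ := fun k t =>
  have hn : 0 < n := by
    rcases Nat.eq_zero_or_pos n with h | h
    · subst h; exact absurd k.2 (by simp)
    · exact h
  (if (k : ℕ) / n = (t : ℕ) / n then
      M ⟨(k : ℕ) % n, Nat.mod_lt _ hn⟩ ⟨(t : ℕ) % n, Nat.mod_lt _ hn⟩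
    else 0) +
  (if (k : ℕ) % n = (t : ℕ) % n then
      M ⟨(k : ℕ) / n, Nat.div_lt_of_lt_mul k.2⟩ ⟨(t : ℕ) / n, Nat.div_lt_of_lt_mul t.2⟩
    else 0)

/-- Evaluation of the Chebyshev polynomials of the first kind through the Joukowski map. -/
theorem chebyshevT_eval_joukowski (w : ℂ) (hw : w ≠ 0) (k : ℤ) :
    (Polynomial.Chebyshev.T ℂ k).eval ((w + w⁻¹) / 2) = (w ^ k + (w ^ k)⁻¹) / 2 := by
  obtain ⟨θ, rfl⟩ : ∃ θ : ℂ, w = Complex.exp (θ * Complex.I) :=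
    ⟨-Complex.I * Complex.log w, by
      rw [show -Complex.I * Complex.log w * Complex.I =
        -(Complex.I * Complex.I) * Complex.log w by ring, Complex.I_mul_I]
      simp [Complex.exp_log hw]⟩
  have hcos (x : ℂ) :
      (Complex.exp (x * Complex.I) + (Complex.exp (x * Complex.I))⁻¹) / 2 = Complex.cos x := by
    rw [← Complex.exp_neg, Complex.cos, neg_mul]
  rw [hcos, Polynomial.Chebyshev.T_complex_cos, ← Complex.exp_int_mul, ← mul_assoc, hcos]

theorem exists_polynomial_approx_inv_sub (u : ℂ) (hu : 1 < ‖u‖) (N : ℕ) :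
    ∃ P : Polynomial ℂ, P.natDegree ≤ N ∧ ∀ x : ℝ, x ∈ Set.Icc (-1) 1 →
      ‖1 / ((x : ℂ) - (u + u⁻¹) / 2) - P.eval (x : ℂ)‖ ≤
        4 * (‖u‖ ^ 2 / (‖u‖ ^ 2 - 1) ^ 2) * (1 / ‖u‖) ^ N := by
  have hu0 : u ≠ 0 := by
    rintro rfl
    norm_num at hu
  set v := (starRingEnd ℂ) u with hv
  set a := (u + u⁻¹) / 2 with ha
  set T := Polynomial.Chebyshev.T ℂ
  set Q : Polynomial ℂ := Polynomial.C (1 + v / u) * T N - Polynomial.C v * T (N + 1)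
    - Polynomial.C u⁻¹ * T (N - 1) with hQ
  set K : ℂ := u ^ N * (1 - u * v) * (1 - (u⁻¹) ^ 2) / 2 with hK
  have hr : 1 < ‖u‖ ^ 2 := by nlinarith
  have huv : u * v = ((‖u‖ ^ 2 : ℝ) : ℂ) := by
    rw [hv, Complex.mul_conj, Complex.normSq_eq_norm_sq]
  have hev (w : ℂ) (hw : w ≠ 0) : Q.eval ((w + w⁻¹) / 2) =
      ((1 + v / u) * (w ^ N + (w ^ N)⁻¹) - v * (w ^ N * w + (w ^ N)⁻¹ * w⁻¹)
        - u⁻¹ * (w ^ N * w⁻¹ + (w ^ N)⁻¹ * w)) / 2 := by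
    simp only [hQ, Polynomial.eval_sub, Polynomial.eval_mul, Polynomial.eval_C, T,
      chebyshevT_eval_joukowski w hw, zpow_add₀ hw, zpow_sub₀ hw, zpow_natCast, zpow_one]
    field_simp
  have hQa : Q.eval a = K := by
    rw [ha, hev u hu0, hK]
    field_simp
    ring
  have hKn : (2 : ℝ) / ‖K‖ ≤ 4 * (‖u‖ ^ 2 / (‖u‖ ^ 2 - 1) ^ 2) * (1 / ‖u‖) ^ N ∧ 0 < ‖K‖ := by
    have h1 : ‖1 - u * v‖ = ‖u‖ ^ 2 - 1 := by
      rw [huv, ← Complex.ofReal_one, ← Complex.ofReal_sub, Complex.norm_real, Real.norm_eq_abs,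
        abs_sub_comm, abs_of_pos (by linarith)]
    have h2 : (‖u‖ ^ 2 - 1) / ‖u‖ ^ 2 ≤ ‖1 - (u⁻¹) ^ 2‖ := by
      have := norm_sub_norm_le (1 : ℂ) ((u⁻¹) ^ 2)
      rw [norm_one, norm_pow, norm_inv] at this
      refine le_trans (le_of_eq ?_) this
      field_simp
    have h3 : ‖u‖ ^ N * (‖u‖ ^ 2 - 1) * ((‖u‖ ^ 2 - 1) / ‖u‖ ^ 2) / 2 ≤ ‖K‖ := by
      rw [hK, norm_div, norm_mul, norm_mul, norm_pow, h1, Complex.norm_ofNat]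
      have : 0 ≤ ‖u‖ ^ N * (‖u‖ ^ 2 - 1) := mul_nonneg (by positivity) (by linarith)
      gcongr
    have h4 : 0 < ‖u‖ ^ 2 - 1 := by linarith
    have h5 : 0 < ‖u‖ ^ N * (‖u‖ ^ 2 - 1) * ((‖u‖ ^ 2 - 1) / ‖u‖ ^ 2) / 2 := by positivity
    refine ⟨(div_le_div_of_nonneg_left (by norm_num) h5 h3).trans (le_of_eq ?_), h5.trans_le h3⟩
    rw [one_div, inv_pow]
    field_simp
    norm_num
  obtain ⟨hKle, hKpos⟩ := hKn
  have hK0 : K ≠ 0 := norm_pos_iff.1 hKpos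
  obtain ⟨D, hD⟩ : Polynomial.X - Polynomial.C a ∣ Q - Polynomial.C K := by
    rw [Polynomial.dvd_iff_isRoot]
    simp [hQa]
  have hQdeg : (Q - Polynomial.C K).natDegree ≤ N + 1 := by
    have hT (c : ℂ) (k : ℤ) (hk : k.natAbs ≤ N + 1) :
        (Polynomial.C c * T k).natDegree ≤ N + 1 :=
      (Polynomial.natDegree_C_mul_le _ _).trans (by rwa [Polynomial.Chebyshev.natDegree_T])
    rw [Polynomial.natDegree_sub_C]
    refine (Polynomial.natDegree_sub_le_of_le (Polynomial.natDegree_sub_le_of_le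
      (hT _ _ ?_) (hT _ _ ?_)) (hT _ _ ?_)).trans (by simp)
    all_goals omega
  have hDdeg : D.natDegree ≤ N := by
    by_cases hD0 : D = 0
    · simp [hD0]
    · rw [hD, Polynomial.natDegree_mul (Polynomial.X_sub_C_ne_zero a) hD0,
        Polynomial.natDegree_X_sub_C] at hQdeg
      omega
  refine ⟨Polynomial.C (-K⁻¹) * D, (Polynomial.natDegree_C_mul_le _ _).trans hDdeg, ?_⟩
  intro x hx
  set w : ℂ := Complex.exp (Real.arccos x * Complex.I) with hw
  have hwn : ‖w‖ = 1 := Complex.norm_exp_ofReal_mul_I _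
  have hw0 : w ≠ 0 := Complex.exp_ne_zero _
  have hxw : (x : ℂ) = (w + w⁻¹) / 2 := by
    rw [hw, ← Complex.exp_neg, ← neg_mul, ← Complex.cos, ← Complex.ofReal_cos,
      Real.cos_arccos hx.1 hx.2]
  have hwu (z : ℂ) (hz : ‖z‖ = 1) : z - u ≠ 0 := by
    intro h
    rw [sub_eq_zero.1 h] at hz
    linarith
  have hone (z : ℂ) (hz : ‖z‖ = 1) : ‖z ^ N * (1 - v * z) / (z - u)‖ = 1 := by
    have h1 : 1 - v * z = (starRingEnd ℂ) (z - u) * z := by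
      rw [map_sub, sub_mul, Complex.conj_mul', hz, hv]
      simp [mul_comm]
    have h2 : ‖1 - v * z‖ = ‖z - u‖ := by
      rw [h1, norm_mul, hz, mul_one, Complex.norm_conj]
    rw [norm_div, norm_mul, norm_pow, hz, h2, one_pow, one_mul,
      div_self (norm_ne_zero_iff.2 (hwu z hz))]
  have hwin : ‖w⁻¹‖ = 1 := by rw [norm_inv, hwn, inv_one]
  have h1 := hwu w hwn
  have h2 := hwu w⁻¹ hwin
  have h3 : 1 - u * w ≠ 0 := by
    intro h
    apply h2
    field_simp
    linear_combination h
  have hza : (x : ℂ) - a = (w - u) * (w⁻¹ - u) * (-(u⁻¹)) / 2 := by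
    rw [hxw, ha]
    field_simp
    ring
  have hza0 : (x : ℂ) - a ≠ 0 := by
    rw [hza]
    have := inv_ne_zero hu0
    simp [h1, h2, this]
  have hQx : Q.eval (x : ℂ) = ((x : ℂ) - a) *
      (w ^ N * (1 - v * w) / (w - u) + (w⁻¹) ^ N * (1 - v * w⁻¹) / (w⁻¹ - u)) := by
    rw [hza]
    have : (w - u) * (w⁻¹ - u) * (-(u⁻¹)) / 2 *
      (w ^ N * (1 - v * w) / (w - u) + (w⁻¹) ^ N * (1 - v * w⁻¹) / (w⁻¹ - u)) =
      -(u⁻¹) / 2 * ((w⁻¹ - u) * (w ^ N * (1 - v * w)) + (w - u) * ((w⁻¹) ^ N * (1 - v * w⁻¹))) := by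
      generalize w⁻¹ = y at *
      field_simp
    rw [this, hxw, hev w hw0, inv_pow]
    field_simp
    ring
  have hDx : Q.eval (x : ℂ) - K = ((x : ℂ) - a) * D.eval (x : ℂ) := by
    have := congrArg (Polynomial.eval (x : ℂ)) hD
    simpa using this
  have herr : 1 / ((x : ℂ) - a) - (Polynomial.C (-K⁻¹) * D).eval (x : ℂ) =
      (w ^ N * (1 - v * w) / (w - u) + (w⁻¹) ^ N * (1 - v * w⁻¹) / (w⁻¹ - u)) / K := by
    rw [Polynomial.eval_mul, Polynomial.eval_C]
    rw [hQx] at hDx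
    generalize w ^ N * (1 - v * w) / (w - u) + (w⁻¹) ^ N * (1 - v * w⁻¹) / (w⁻¹ - u) = E at *
    field_simp
    linear_combination -hDx
  rw [herr, norm_div]
  refine le_trans ?_ hKle
  gcongr
  refine (norm_add_le _ _).trans (le_of_eq ?_)
  rw [hone w hwn, hone _ hwin]
  norm_num

/-- The inverse Joukowski image of a point outside `[-1, 1]` has modulus determined by the
confocal ellipse through that point. -/
theorem exists_joukowski_preimage (a : ℂ) (α : ℝ) (hα : 1 < α)
    (ha : ‖a - 1‖ + ‖a + 1‖ = 2 * α) :
    ∃ u : ℂ, a = (u + u⁻¹) / 2 ∧ ‖u‖ = α + √(α ^ 2 - 1) := by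
  obtain ⟨s, hs⟩ := IsAlgClosed.exists_pow_nat_eq (a ^ 2 - 1) (n := 2) (by norm_num)
  have hprod : (a + s) * (a - s) = 1 := by linear_combination -hs
  obtain ⟨u, hu1, hua⟩ : ∃ u : ℂ, 1 ≤ ‖u‖ ∧ a = (u + u⁻¹) / 2 := by
    have hn : ‖a + s‖ * ‖a - s‖ = 1 := by rw [← norm_mul, hprod, norm_one]
    rcases le_total 1 ‖a + s‖ with h | h
    · refine ⟨a + s, h, ?_⟩
      rw [inv_eq_of_mul_eq_one_right hprod]
      ring
    · refine ⟨a - s, ?_, ?_⟩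
      · nlinarith [norm_nonneg (a - s), norm_nonneg (a + s)]
      · rw [inv_eq_of_mul_eq_one_left hprod]
        ring
  refine ⟨u, hua, ?_⟩
  have hu0 : u ≠ 0 := by
    rintro rfl
    norm_num at hu1
  have hr : 0 < ‖u‖ := by linarith
  have h1 : ‖a - 1‖ = ‖u - 1‖ ^ 2 / (2 * ‖u‖) := by
    rw [show a - 1 = (u - 1) ^ 2 / (2 * u) by rw [hua]; field_simp; ring]
    simp
  have h2 : ‖a + 1‖ = ‖u + 1‖ ^ 2 / (2 * ‖u‖) := by
    rw [show a + 1 = (u + 1) ^ 2 / (2 * u) by rw [hua]; field_simp; ring]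
    simp
  have h3 := parallelogram_law_with_norm ℝ u 1
  have h4 : ‖u‖ ^ 2 + 1 = 2 * α * ‖u‖ := by
    rw [h1, h2] at ha
    field_simp at ha
    rw [norm_one] at h3
    nlinarith
  have h5 : (‖u‖ - α) ^ 2 = α ^ 2 - 1 := by nlinarith
  have h6 : 0 ≤ ‖u‖ - α := by
    by_contra h
    push Not at h
    nlinarith
  rw [← h5, Real.sqrt_sq h6]
  ring

theorem one_lt_ellipse_parameter {lo hi : ℝ} (hlo : 0 < lo) (hlt : lo < hi) (ω : ℝ) :
    (hi + lo) / (hi - lo) ≤ (√(lo ^ 2 + ω ^ 2) + √(hi ^ 2 + ω ^ 2)) / (hi - lo) ∧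
      1 < (√(lo ^ 2 + ω ^ 2) + √(hi ^ 2 + ω ^ 2)) / (hi - lo) := by
  have h1 : lo ≤ √(lo ^ 2 + ω ^ 2) := Real.le_sqrt_of_sq_le (by nlinarith [sq_nonneg ω])
  have h2 : hi ≤ √(hi ^ 2 + ω ^ 2) := Real.le_sqrt_of_sq_le (by nlinarith [sq_nonneg ω])
  have hd : 0 < hi - lo := by linarith
  refine ⟨by gcongr ?_ / _; linarith, ?_⟩
  rw [lt_div_iff₀ hd]
  linarith

theorem exists_polynomial_approx_inv_add_I {lo hi : ℝ} (hlo : 0 < lo) (hlt : lo < hi) (ω : ℝ)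
    (α r : ℝ) (hα : α = (√(lo ^ 2 + ω ^ 2) + √(hi ^ 2 + ω ^ 2)) / (hi - lo))
    (hr : r = α + √(α ^ 2 - 1)) (N : ℕ) :
    ∃ P : Polynomial ℂ, P.natDegree ≤ N ∧ ∀ x : ℝ, x ∈ Set.Icc lo hi →
      ‖1 / ((x : ℂ) + ω * Complex.I) - P.eval (x : ℂ)‖ ≤
        8 / (hi - lo) * (r ^ 2 / (r ^ 2 - 1) ^ 2) * (1 / r) ^ N := by
  have hd : 0 < hi - lo := by linarith
  have hdc : (hi : ℂ) - lo ≠ 0 := by exact_mod_cast hd.ne'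
  have hα1 : 1 < α := hα ▸ (one_lt_ellipse_parameter hlo hlt ω).2
  have hnorm (y : ℝ) : ‖-(2 * ((y : ℂ) + ω * Complex.I) / (hi - lo))‖ =
      2 * √(y ^ 2 + ω ^ 2) / (hi - lo) := by
    rw [norm_neg, norm_div, norm_mul, Complex.norm_add_mul_I, ← Complex.ofReal_sub,
      Complex.norm_real, Real.norm_eq_abs, abs_of_pos hd, Complex.norm_ofNat]
  obtain ⟨u, hu, hun⟩ := exists_joukowski_preimage
    (-((hi + lo + 2 * (ω * Complex.I)) / (hi - lo))) α hα1 (by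
      rw [show -((hi + lo + 2 * (ω * Complex.I)) / (hi - lo)) - 1 =
          -(2 * ((hi : ℂ) + ω * Complex.I) / (hi - lo)) by field_simp; ring,
        show -((hi + lo + 2 * (ω * Complex.I)) / (hi - lo)) + 1 =
          -(2 * ((lo : ℂ) + ω * Complex.I) / (hi - lo)) by field_simp; ring,
        hnorm, hnorm, hα]
      ring)
  rw [← hr] at hun
  have hu1 : 1 < ‖u‖ := by
    rw [hun, hr]
    linarith [Real.sqrt_nonneg (α ^ 2 - 1)]
  obtain ⟨P, hP, hPb⟩ := exists_polynomial_approx_inv_sub u hu1 N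
  set L : Polynomial ℂ := Polynomial.C (2 / ((hi : ℂ) - lo)) * Polynomial.X +
    Polynomial.C (-(((hi : ℂ) + lo) / (hi - lo)))
  refine ⟨Polynomial.C (2 / ((hi : ℂ) - lo)) * P.comp L, ?_, ?_⟩
  · refine (Polynomial.natDegree_C_mul_le _ _).trans ?_
    rw [Polynomial.natDegree_comp]
    have : L.natDegree ≤ 1 := Polynomial.natDegree_linear_le
    nlinarith
  · intro x hx
    have hb := hPb ((2 * x - (hi + lo)) / (hi - lo)) (by
      constructor
      · rw [le_div_iff₀ hd]
        linarith [hx.1]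
      · rw [div_le_iff₀ hd]
        linarith [hx.2])
    have hx0 : (x : ℂ) + ω * Complex.I ≠ 0 := by
      intro h
      have := congrArg Complex.re h
      simp at this
      linarith [hx.1]
    have heL : L.eval (x : ℂ) = (((2 * x - (hi + lo)) / (hi - lo) : ℝ) : ℂ) := by
      simp only [L, Polynomial.eval_add, Polynomial.eval_mul, Polynomial.eval_C,
        Polynomial.eval_X]
      push_cast
      field_simp
      ring
    have hz : 1 / ((x : ℂ) + ω * Complex.I) = 2 / ((hi : ℂ) - lo) *
        (1 / ((((2 * x - (hi + lo)) / (hi - lo) : ℝ) : ℂ) - (u + u⁻¹) / 2)) := by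
      rw [← hu]
      push_cast
      rw [show (2 * (x : ℂ) - (hi + lo)) / (hi - lo) -
        -((hi + lo + 2 * (ω * Complex.I)) / (hi - lo)) =
          2 * ((x : ℂ) + ω * Complex.I) / (hi - lo) by field_simp; ring]
      field_simp
    rw [Polynomial.eval_mul, Polynomial.eval_C, Polynomial.eval_comp, heL, hz, ← mul_sub,
      norm_mul]
    have h2 : ‖2 / ((hi : ℂ) - lo)‖ = 2 / (hi - lo) := by
      rw [norm_div, ← Complex.ofReal_sub, Complex.norm_real, Real.norm_eq_abs, abs_of_pos hd,
        Complex.norm_ofNat]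
    rw [h2]
    refine (mul_le_mul_of_nonneg_left hb (by positivity)).trans (le_of_eq ?_)
    rw [hun]
    ring

theorem sum_eigenvectorBasis_mul_eq_ite {ι : Type*} [Fintype ι] [DecidableEq ι]
    {M : Matrix ι ι ℝ} (hM : M.IsHermitian) (a b : ι) :
    ∑ p, hM.eigenvectorBasis p a * hM.eigenvectorBasis p b = if a = b then 1 else 0 := by
  have hU : (hM.eigenvectorUnitary : Matrix ι ι ℝ) * star (hM.eigenvectorUnitary : Matrix ι ι ℝ) =
      1 := Unitary.mul_star_self_of_mem hM.eigenvectorUnitary.2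
  have h := congrFun (congrFun hU a) b
  rw [Matrix.mul_apply] at h
  simpa [Matrix.star_apply, Matrix.one_apply,
    Matrix.IsHermitian.eigenvectorUnitary_apply] using h

theorem sum_mul_eigenvectorBasis {ι : Type*} [Fintype ι] [DecidableEq ι]
    {M : Matrix ι ι ℝ} (hM : M.IsHermitian) (a p : ι) :
    ∑ c, M a c * hM.eigenvectorBasis p c = hM.eigenvalues p * hM.eigenvectorBasis p a := by
  have h := congrFun (hM.mulVec_eigenvectorBasis p) a
  simpa [Matrix.mulVec, dotProduct] using h

theorem sum_abs_eigenvectorBasis_mul_le_one {ι : Type*} [Fintype ι] [DecidableEq ι]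
    {M : Matrix ι ι ℝ} (hM : M.IsHermitian) (a b : ι) :
    ∑ p, |hM.eigenvectorBasis p a * hM.eigenvectorBasis p b| ≤ 1 := by
  have ha := sum_eigenvectorBasis_mul_eq_ite hM a a
  have hb := sum_eigenvectorBasis_mul_eq_ite hM b b
  rw [if_pos rfl] at ha hb
  calc ∑ p, |hM.eigenvectorBasis p a * hM.eigenvectorBasis p b|
      ≤ ∑ p, (hM.eigenvectorBasis p a * hM.eigenvectorBasis p a +
          hM.eigenvectorBasis p b * hM.eigenvectorBasis p b) / 2 := by
        refine Finset.sum_le_sum fun p _ => ?_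
        rw [abs_le]
        constructor
        · nlinarith [sq_nonneg (hM.eigenvectorBasis p a + hM.eigenvectorBasis p b)]
        · nlinarith [sq_nonneg (hM.eigenvectorBasis p a - hM.eigenvectorBasis p b)]
    _ = 1 := by
        rw [← Finset.sum_div, Finset.sum_add_distrib, ha, hb]
        norm_num

/-- Powers of a tridiagonal symmetric matrix are banded. -/
theorem sum_eigenvectorBasis_mul_pow_eq_zero {n : ℕ} {M : Matrix (Fin n) (Fin n) ℝ}
    (hM : M.IsHermitian) (htri : ∀ a c : Fin n, 1 < |(a : ℤ) - (c : ℤ)| → M a c = 0)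
    (r : ℕ) (a b : Fin n) (hab : (r : ℤ) < |(a : ℤ) - (b : ℤ)|) :
    ∑ p, hM.eigenvectorBasis p a * hM.eigenvectorBasis p b * hM.eigenvalues p ^ r = 0 := by
  induction r generalizing a with
  | zero =>
    have hne : a ≠ b := by
      rintro rfl
      simp at hab
    simpa [hne] using sum_eigenvectorBasis_mul_eq_ite hM a b
  | succ r ih =>
    have hstep : ∑ p, hM.eigenvectorBasis p a * hM.eigenvectorBasis p b *
        hM.eigenvalues p ^ (r + 1) = ∑ c, M a c *
          ∑ p, hM.eigenvectorBasis p c * hM.eigenvectorBasis p b * hM.eigenvalues p ^ r := by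
      simp_rw [Finset.mul_sum]
      rw [Finset.sum_comm]
      refine Finset.sum_congr rfl fun p _ => ?_
      rw [show hM.eigenvectorBasis p a * hM.eigenvectorBasis p b * hM.eigenvalues p ^ (r + 1) =
        (hM.eigenvalues p * hM.eigenvectorBasis p a) *
          (hM.eigenvectorBasis p b * hM.eigenvalues p ^ r) by ring,
        ← sum_mul_eigenvectorBasis hM a p, Finset.sum_mul]
      exact Finset.sum_congr rfl fun c _ => by ring
    rw [hstep]
    refine Finset.sum_eq_zero fun c _ => ?_
    by_cases hc : 1 < |(a : ℤ) - (c : ℤ)|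
    · rw [htri a c hc, zero_mul]
    · rw [ih c, mul_zero]
      have := abs_sub_le (a : ℤ) c b
      push_cast at hab
      omega

theorem sum_eigenvectorBasis_mul_polynomial_eq_zero {n : ℕ} {M : Matrix (Fin n) (Fin n) ℝ}
    (hM : M.IsHermitian) (htri : ∀ a c : Fin n, 1 < |(a : ℤ) - (c : ℤ)| → M a c = 0)
    (P : Polynomial ℂ) (a b : Fin n) (hab : (P.natDegree : ℤ) < |(a : ℤ) - (b : ℤ)|) :
    ∑ p, ((hM.eigenvectorBasis p a * hM.eigenvectorBasis p b : ℝ) : ℂ) *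
      P.eval ((hM.eigenvalues p : ℝ) : ℂ) = 0 := by
  simp_rw [Polynomial.eval_eq_sum_range, Finset.mul_sum]
  rw [Finset.sum_comm]
  refine Finset.sum_eq_zero fun r hr => ?_
  have h := sum_eigenvectorBasis_mul_pow_eq_zero hM htri r a b (by
    have := Finset.mem_range.1 hr
    omega)
  have h' := congrArg (fun x : ℝ => P.coeff r * (x : ℂ)) h
  simp only [Complex.ofReal_sum, Complex.ofReal_zero, mul_zero, Finset.mul_sum] at h'
  rw [← h']
  refine Finset.sum_congr rfl fun p _ => ?_
  push_cast
  ring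

/-- Off-diagonal decay of the shifted inverse `(M + iω)⁻¹`, written in an eigenbasis of `M`. -/
theorem norm_shifted_inverse_entry_le {n : ℕ} {M : Matrix (Fin n) (Fin n) ℝ}
    (hM : M.IsHermitian) (htri : ∀ a c : Fin n, 1 < |(a : ℤ) - (c : ℤ)| → M a c = 0)
    {lo hi : ℝ} (hlo : 0 < lo) (hlt : lo < hi)
    (hmem : ∀ p, hM.eigenvalues p ∈ Set.Icc lo hi) (ω α r : ℝ)
    (hα : α = (√(lo ^ 2 + ω ^ 2) + √(hi ^ 2 + ω ^ 2)) / (hi - lo))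
    (hr : r = α + √(α ^ 2 - 1)) (N : ℕ) (a b : Fin n)
    (hab : |(a : ℤ) - (b : ℤ)| = N + 1) :
    ‖∑ p, ((hM.eigenvectorBasis p a * hM.eigenvectorBasis p b : ℝ) : ℂ) *
      (1 / (((hM.eigenvalues p : ℝ) : ℂ) + ω * Complex.I))‖ ≤
        8 / (hi - lo) * (r ^ 2 / (r ^ 2 - 1) ^ 2) * (1 / r) ^ N := by
  obtain ⟨P, hP, hPb⟩ := exists_polynomial_approx_inv_add_I hlo hlt ω α r hα hr N
  have h0 := sum_eigenvectorBasis_mul_polynomial_eq_zero hM htri P a b (by omega)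
  set B := 8 / (hi - lo) * (r ^ 2 / (r ^ 2 - 1) ^ 2) * (1 / r) ^ N
  have hB : 0 ≤ B := (norm_nonneg _).trans (hPb lo ⟨le_rfl, hlt.le⟩)
  rw [← sub_zero (∑ p, _), ← h0, ← Finset.sum_sub_distrib]
  calc _ ≤ ∑ p, |hM.eigenvectorBasis p a * hM.eigenvectorBasis p b| * B := by
        refine norm_sum_le_of_le _ fun p _ => ?_
        rw [← mul_sub, norm_mul, Complex.norm_real, Real.norm_eq_abs]
        exact mul_le_mul_of_nonneg_left (hPb _ (hmem p)) (abs_nonneg _)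
    _ ≤ 1 * B := by
        rw [← Finset.sum_mul]
        exact mul_le_mul_of_nonneg_right (sum_abs_eigenvectorBasis_mul_le_one hM a b) hB
    _ = B := one_mul B

theorem kronSum_inv_apply {n : ℕ} {M : Matrix (Fin n) (Fin n) ℝ} (hM : M.PosDef)
    (k t : Fin (n * n)) :
    (kronSum n M)⁻¹ k t = ∑ p, ∑ q,
      (hM.1.eigenvectorBasis p k.divNat * hM.1.eigenvectorBasis p t.divNat) *
      (hM.1.eigenvectorBasis q k.modNat * hM.1.eigenvectorBasis q t.modNat) /
        (hM.1.eigenvalues p + hM.1.eigenvalues q) := by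
  set T : Matrix (Fin (n * n)) (Fin (n * n)) ℝ := fun k t => ∑ p, ∑ q,
      (hM.1.eigenvectorBasis p k.divNat * hM.1.eigenvectorBasis p t.divNat) *
      (hM.1.eigenvectorBasis q k.modNat * hM.1.eigenvectorBasis q t.modNat) /
        (hM.1.eigenvalues p + hM.1.eigenvalues q) with hT
  suffices h : kronSum n M * T = 1 by
    rw [Matrix.inv_eq_right_inv h]
  have hS (k s : Fin (n * n)) : kronSum n M k s =
      (if k.divNat = s.divNat then M k.modNat s.modNat else 0) +
      (if k.modNat = s.modNat then M k.divNat s.divNat else 0) := by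
    simp only [Fin.ext_iff]
    rfl
  have heig (k : Fin (n * n)) (p q : Fin n) :
      ∑ s, kronSum n M k s *
        (hM.1.eigenvectorBasis p s.divNat * hM.1.eigenvectorBasis q s.modNat) =
      (hM.1.eigenvalues p + hM.1.eigenvalues q) *
        (hM.1.eigenvectorBasis p k.divNat * hM.1.eigenvectorBasis q k.modNat) := by
    rw [← finProdFinEquiv.sum_comp, Fintype.sum_prod_type]
    have hdiv (x y : Fin n) : (finProdFinEquiv (x, y)).divNat = x :=
      congrArg Prod.fst (finProdFinEquiv.symm_apply_apply (x, y))
    have hmod (x y : Fin n) : (finProdFinEquiv (x, y)).modNat = y :=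
      congrArg Prod.snd (finProdFinEquiv.symm_apply_apply (x, y))
    simp only [hS, hdiv, hmod, add_mul, ite_mul, zero_mul, Finset.sum_add_distrib,
      Finset.sum_ite_eq, Finset.mem_univ, if_true]
    rw [Finset.sum_comm]
    simp only [Finset.sum_ite_eq, Finset.mem_univ, if_true]
    have h1 := sum_mul_eigenvectorBasis hM.1 k.divNat p
    have h2 := sum_mul_eigenvectorBasis hM.1 k.modNat q
    simp_rw [← mul_assoc, ← Finset.sum_mul]
    rw [h1]
    simp_rw [mul_right_comm _ (hM.1.eigenvectorBasis p k.divNat), ← Finset.sum_mul]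
    rw [h2]
    ring
  ext k t
  have hpos (p q : Fin n) : hM.1.eigenvalues p + hM.1.eigenvalues q ≠ 0 :=
    (add_pos (hM.eigenvalues_pos p) (hM.eigenvalues_pos q)).ne'
  calc (kronSum n M * T) k t
      = ∑ p, ∑ q, (∑ s, kronSum n M k s *
          (hM.1.eigenvectorBasis p s.divNat * hM.1.eigenvectorBasis q s.modNat)) *
          ((hM.1.eigenvectorBasis p t.divNat * hM.1.eigenvectorBasis q t.modNat) /
            (hM.1.eigenvalues p + hM.1.eigenvalues q)) := by
        simp_rw [Matrix.mul_apply, hT, Finset.mul_sum, Finset.sum_mul]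
        rw [Finset.sum_comm]
        refine Finset.sum_congr rfl fun p _ => ?_
        rw [Finset.sum_comm]
        refine Finset.sum_congr rfl fun q _ => Finset.sum_congr rfl fun s _ => ?_
        ring
    _ = ∑ p, ∑ q, (hM.1.eigenvectorBasis p k.divNat * hM.1.eigenvectorBasis p t.divNat) *
          (hM.1.eigenvectorBasis q k.modNat * hM.1.eigenvectorBasis q t.modNat) := by
        refine Finset.sum_congr rfl fun p _ => Finset.sum_congr rfl fun q _ => ?_
        rw [heig]
        field_simp [hpos p q]
    _ = (1 : Matrix (Fin (n * n)) (Fin (n * n)) ℝ) k t := by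
        rw [← Finset.sum_mul_sum, sum_eigenvectorBasis_mul_eq_ite,
          sum_eigenvectorBasis_mul_eq_ite, Matrix.one_apply]
        have : k = t ↔ k.divNat = t.divNat ∧ k.modNat = t.modNat := by
          rw [← finProdFinEquiv.symm.injective.eq_iff, Prod.ext_iff]
          rfl
        simp only [this]
        split_ifs <;> simp_all

theorem integrable_div_sq_add_sq {a : ℝ} (ha : 0 < a) :
    Integrable fun ω : ℝ => a / (a ^ 2 + ω ^ 2) := by
  have h := (integrable_inv_one_add_sq.comp_div ha.ne').const_mul a⁻¹
  refine h.congr (Filter.Eventually.of_forall fun ω => ?_)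
  have : a ^ 2 + ω ^ 2 ≠ 0 := by positivity
  have : 1 + (ω / a) ^ 2 ≠ 0 := by positivity
  field_simp

theorem integral_univ_div_sq_add_sq {a : ℝ} (ha : 0 < a) :
    ∫ ω : ℝ, a / (a ^ 2 + ω ^ 2) = Real.pi := by
  have h : ∀ ω : ℝ, a / (a ^ 2 + ω ^ 2) = a⁻¹ * (1 + (ω / a) ^ 2)⁻¹ := by
    intro ω
    have : a ^ 2 + ω ^ 2 ≠ 0 := by positivity
    have : 1 + (ω / a) ^ 2 ≠ 0 := by positivity
    field_simp
  simp_rw [h]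
  rw [integral_const_mul, Measure.integral_comp_div (fun x => (1 + x ^ 2)⁻¹),
    integral_univ_inv_one_add_sq, abs_of_pos ha, smul_eq_mul]
  field_simp

theorem re_inv_add_mul_inv_sub {a b : ℝ} (ha : 0 < a) (hb : 0 < b) (ω : ℝ) :
    ((1 / ((a : ℂ) + ω * Complex.I)) * (1 / ((b : ℂ) + (-ω : ℝ) * Complex.I))).re =
      1 / (a + b) * (a / (a ^ 2 + ω ^ 2) + b / (b ^ 2 + ω ^ 2)) := by
  have h1 : a ^ 2 + ω ^ 2 ≠ 0 := by positivity
  have h2 : b ^ 2 + ω ^ 2 ≠ 0 := by positivity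
  simp only [one_div, Complex.mul_re, Complex.inv_re, Complex.inv_im, Complex.normSq_add_mul_I,
    Complex.add_re, Complex.add_im, Complex.mul_im, Complex.ofReal_re, Complex.ofReal_im,
    Complex.I_re, Complex.I_im, neg_sq]
  field_simp
  ring

/-- Integral representation of an entry of the inverse Kronecker sum. -/
theorem kronSum_inv_apply_eq_integral {n : ℕ} {M : Matrix (Fin n) (Fin n) ℝ} (hM : M.PosDef)
    (k t : Fin (n * n)) :
    (kronSum n M)⁻¹ k t = 1 / (2 * Real.pi) * ∫ ω : ℝ,
      ((∑ p, ((hM.1.eigenvectorBasis p k.divNat * hM.1.eigenvectorBasis p t.divNat : ℝ) : ℂ) *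
        (1 / (((hM.1.eigenvalues p : ℝ) : ℂ) + ω * Complex.I))) *
      (∑ q, ((hM.1.eigenvectorBasis q k.modNat * hM.1.eigenvectorBasis q t.modNat : ℝ) : ℂ) *
        (1 / (((hM.1.eigenvalues q : ℝ) : ℂ) + (-ω : ℝ) * Complex.I)))).re := by
  have hpos := hM.eigenvalues_pos
  have hre (ω : ℝ) :
      ((∑ p, ((hM.1.eigenvectorBasis p k.divNat * hM.1.eigenvectorBasis p t.divNat : ℝ) : ℂ) *
        (1 / (((hM.1.eigenvalues p : ℝ) : ℂ) + ω * Complex.I))) *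
      (∑ q, ((hM.1.eigenvectorBasis q k.modNat * hM.1.eigenvectorBasis q t.modNat : ℝ) : ℂ) *
        (1 / (((hM.1.eigenvalues q : ℝ) : ℂ) + (-ω : ℝ) * Complex.I)))).re =
      ∑ p, ∑ q, (hM.1.eigenvectorBasis p k.divNat * hM.1.eigenvectorBasis p t.divNat) *
        (hM.1.eigenvectorBasis q k.modNat * hM.1.eigenvectorBasis q t.modNat) /
          (hM.1.eigenvalues p + hM.1.eigenvalues q) *
        (hM.1.eigenvalues p / (hM.1.eigenvalues p ^ 2 + ω ^ 2) +
          hM.1.eigenvalues q / (hM.1.eigenvalues q ^ 2 + ω ^ 2)) := by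
    rw [Finset.sum_mul_sum, Complex.re_sum]
    refine Finset.sum_congr rfl fun p _ => ?_
    rw [Complex.re_sum]
    refine Finset.sum_congr rfl fun q _ => ?_
    rw [mul_mul_mul_comm, ← Complex.ofReal_mul, Complex.re_ofReal_mul,
      re_inv_add_mul_inv_sub (hpos p) (hpos q)]
    ring
  have hint (p q : Fin n) : Integrable fun ω : ℝ =>
      hM.1.eigenvalues p / (hM.1.eigenvalues p ^ 2 + ω ^ 2) +
        hM.1.eigenvalues q / (hM.1.eigenvalues q ^ 2 + ω ^ 2) :=
    (integrable_div_sq_add_sq (hpos p)).add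
    (integrable_div_sq_add_sq (hpos q))
  simp_rw [hre]
  rw [kronSum_inv_apply hM, integral_finsetSum _ fun p _ => integrable_finsetSum _ fun q _ =>
    (hint p q).const_mul _, Finset.mul_sum]
  refine Finset.sum_congr rfl fun p _ => ?_
  rw [integral_finsetSum _ fun q _ => (hint p q).const_mul _, Finset.mul_sum]
  refine Finset.sum_congr rfl fun q _ => ?_
  rw [integral_const_mul, integral_add (integrable_div_sq_add_sq (hpos p))
    (integrable_div_sq_add_sq (hpos q)), integral_univ_div_sq_add_sq (hpos p),
    integral_univ_div_sq_add_sq (hpos q)]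
  have := Real.pi_pos
  field_simp
  ring

theorem integrable_decay_bound {lo hi : ℝ} (hlo : 0 < lo) (hlt : lo < hi) (α R : ℝ → ℝ)
    (hα : ∀ ω, α ω = (√(lo ^ 2 + ω ^ 2) + √(hi ^ 2 + ω ^ 2)) / (hi - lo))
    (hR : ∀ ω, R ω = α ω + √(α ω ^ 2 - 1)) (N : ℕ) :
    Integrable fun ω : ℝ => (R ω ^ 2 / (R ω ^ 2 - 1) ^ 2) ^ 2 * (1 / R ω) ^ N := by
  have hd : 0 < hi - lo := by linarith
  set c := (hi + lo) / (hi - lo) with hc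
  have hc1 : 1 < c := by
    rw [hc, lt_div_iff₀ hd]
    linarith
  have hRα (ω : ℝ) : α ω ≤ R ω := by
    rw [hR]
    linarith [Real.sqrt_nonneg (α ω ^ 2 - 1)]
  have hcR (ω : ℝ) : c ≤ R ω :=
    ((hα ω).symm ▸ (one_lt_ellipse_parameter hlo hlt ω).1).trans (hRα ω)
  have hωR (ω : ℝ) : ω ^ 2 ≤ (hi - lo) ^ 2 * R ω ^ 2 := by
    have h1 : |ω| ≤ √(lo ^ 2 + ω ^ 2) := Real.abs_le_sqrt (by nlinarith [sq_nonneg lo])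
    have h2 := Real.sqrt_nonneg (hi ^ 2 + ω ^ 2)
    have h3 : |ω| ≤ (hi - lo) * R ω := by
      calc |ω| ≤ (hi - lo) * α ω := by
            rw [hα]
            field_simp
            linarith
        _ ≤ (hi - lo) * R ω := mul_le_mul_of_nonneg_left (hRα ω) hd.le
    rw [← mul_pow, ← sq_abs ω]
    gcongr
  have hαc : Continuous α := by
    rw [funext hα]
    fun_prop
  have hRc : Continuous R := by
    rw [funext hR]
    fun_prop
  have hne1 (ω : ℝ) : (R ω ^ 2 - 1) ^ 2 ≠ 0 := by
    have := hcR ω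
    have : 0 < R ω ^ 2 - 1 := by nlinarith
    positivity
  have hne2 (ω : ℝ) : R ω ≠ 0 := by linarith [hcR ω]
  have hcont : Continuous fun ω : ℝ => (R ω ^ 2 / (R ω ^ 2 - 1) ^ 2) ^ 2 * (1 / R ω) ^ N := by
    fun_prop (disch := first | exact hne1 | exact hne2)
  set D := (c ^ 2 / (c ^ 2 - 1)) ^ 4 * (1 + (hi - lo) ^ 2)
  refine (integrable_inv_one_add_sq.const_mul D).mono' hcont.aestronglyMeasurable
    (Filter.Eventually.of_forall fun ω => ?_)
  have hc2 : 0 < c ^ 2 - 1 := by nlinarith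
  have h1 := hcR ω
  have hr1 : 1 < R ω := by linarith
  have hr2 : 0 < R ω ^ 2 - 1 := by nlinarith
  have h2 : R ω ^ 2 / (R ω ^ 2 - 1) ≤ c ^ 2 / (c ^ 2 - 1) := by
    rw [div_le_div_iff₀ hr2 hc2]
    nlinarith
  have h3 : (1 / R ω) ^ N ≤ 1 :=
    pow_le_one₀ (by positivity) ((div_le_one (by linarith)).2 hr1.le)
  have h4 : 1 / R ω ^ 4 ≤ (1 + (hi - lo) ^ 2) * (1 + ω ^ 2)⁻¹ := by
    rw [← div_eq_mul_inv, div_le_div_iff₀ (by positivity) (by positivity)]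
    have := hωR ω
    have h5 : 1 ≤ R ω ^ 2 := by linarith
    have h6 : R ω ^ 2 ≤ R ω ^ 4 := by nlinarith
    nlinarith [mul_le_mul_of_nonneg_left h6 (sq_nonneg (hi - lo))]
  rw [Real.norm_of_nonneg (by positivity)]
  calc (R ω ^ 2 / (R ω ^ 2 - 1) ^ 2) ^ 2 * (1 / R ω) ^ N
      ≤ (R ω ^ 2 / (R ω ^ 2 - 1) ^ 2) ^ 2 * 1 := by gcongr
    _ = (R ω ^ 2 / (R ω ^ 2 - 1)) ^ 4 * (1 / R ω ^ 4) := by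
        field_simp
    _ ≤ (c ^ 2 / (c ^ 2 - 1)) ^ 4 * ((1 + (hi - lo) ^ 2) * (1 + ω ^ 2)⁻¹) := by gcongr
    _ = D * (1 + ω ^ 2)⁻¹ := by ring

/-- Proposition 2.2 (i): integral bound for the entries of `S⁻¹` when the two
grid indices differ in both coordinates (`M` tridiagonal SPD). -/
theorem kronSum_inv_entry_integral_bound_offdiag
    (n : ℕ) (M : Matrix (Fin n) (Fin n) ℝ) (hM : M.PosDef)
    (htri : ∀ a c : Fin n, 1 < |(a : ℤ) - (c : ℤ)| → M a c = 0)
    (lammin lammax : ℝ)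
    (hmin : IsLeast (Set.range hM.1.eigenvalues) lammin)
    (hmax : IsGreatest (Set.range hM.1.eigenvalues) lammax)
    (hlt : lammin < lammax)
    (k t : ℕ) (hk1 : 1 ≤ k) (hk2 : k ≤ n * n) (ht1 : 1 ≤ t) (ht2 : t ≤ n * n)
    (i j ℓ m : ℕ)
    (hj : j = (t - 1) / n + 1) (hi : i = t - n * ((t - 1) / n))
    (hm : m = (k - 1) / n + 1) (hl : ℓ = k - n * ((k - 1) / n))
    (hne1 : i ≠ ℓ) (hne2 : j ≠ m)
    (α R : ℝ → ℝ)
    (hα : ∀ ω : ℝ, α ω =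
      (Real.sqrt (lammin ^ 2 + ω ^ 2) + Real.sqrt (lammax ^ 2 + ω ^ 2)) / (lammax - lammin))
    (hR : ∀ ω : ℝ, R ω = α ω + Real.sqrt (α ω ^ 2 - 1)) :
    |(kronSum n M)⁻¹ ⟨k - 1, by omega⟩ ⟨t - 1, by omega⟩| ≤
      (1 / (2 * Real.pi)) * (64 / (lammax - lammin) ^ 2) *
        ∫ ω : ℝ, (R ω ^ 2 / (R ω ^ 2 - 1) ^ 2) ^ 2 *
          (1 / R ω) ^ (|(i : ℝ) - (ℓ : ℝ)| + |(j : ℝ) - (m : ℝ)| - 2) := by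
  obtain ⟨p₀, hp₀⟩ := hmin.1
  have hlo : 0 < lammin := hp₀ ▸ hM.eigenvalues_pos p₀
  have hmem (p : Fin n) : hM.1.eigenvalues p ∈ Set.Icc lammin lammax :=
    ⟨hmin.2 ⟨p, rfl⟩, hmax.2 ⟨p, rfl⟩⟩
  have hd : 0 < lammax - lammin := by linarith
  set k' : Fin (n * n) := ⟨k - 1, by omega⟩
  set t' : Fin (n * n) := ⟨t - 1, by omega⟩
  have hmk : m = (k'.divNat : ℕ) + 1 := hm
  have hjt : j = (t'.divNat : ℕ) + 1 := hj
  have hlk : ℓ = (k'.modNat : ℕ) + 1 := by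
    have h1 : (k'.modNat : ℕ) = (k - 1) % n := rfl
    have h2 := Nat.div_add_mod (k - 1) n
    omega
  have hit : i = (t'.modNat : ℕ) + 1 := by
    have h1 : (t'.modNat : ℕ) = (t - 1) % n := rfl
    have h2 := Nat.div_add_mod (t - 1) n
    omega
  obtain ⟨N₁, hN₁⟩ : ∃ N : ℕ, |(k'.divNat : ℤ) - (t'.divNat : ℤ)| = N + 1 := by
    have : 0 < |(k'.divNat : ℤ) - (t'.divNat : ℤ)| := abs_pos.2 (by omega)
    exact ⟨(|(k'.divNat : ℤ) - (t'.divNat : ℤ)| - 1).toNat, by omega⟩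
  obtain ⟨N₂, hN₂⟩ : ∃ N : ℕ, |(k'.modNat : ℤ) - (t'.modNat : ℤ)| = N + 1 := by
    have : 0 < |(k'.modNat : ℤ) - (t'.modNat : ℤ)| := abs_pos.2 (by omega)
    exact ⟨(|(k'.modNat : ℤ) - (t'.modNat : ℤ)| - 1).toNat, by omega⟩
  have hexp : |(i : ℝ) - (ℓ : ℝ)| + |(j : ℝ) - (m : ℝ)| - 2 = ((N₁ + N₂ : ℕ) : ℝ) := by
    have h1 : |(i : ℤ) - ℓ| + |(j : ℤ) - m| - 2 = ((N₁ + N₂ : ℕ) : ℤ) := by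
      rw [abs_sub_comm (i : ℤ), abs_sub_comm (j : ℤ), hit, hlk, hjt, hmk]
      push_cast
      rw [add_sub_add_right_eq_sub, add_sub_add_right_eq_sub, hN₁, hN₂]
      ring
    exact_mod_cast h1
  simp_rw [hexp, Real.rpow_natCast]
  rw [kronSum_inv_apply_eq_integral hM, abs_mul, abs_of_pos (by positivity), mul_assoc]
  refine mul_le_mul_of_nonneg_left ?_ (by positivity)
  rw [← integral_const_mul, ← Real.norm_eq_abs]
  refine norm_integral_le_of_norm_le
    ((integrable_decay_bound hlo hlt α R hα hR (N₁ + N₂)).const_mul _)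
    (Filter.Eventually.of_forall fun ω => ?_)
  rw [Real.norm_eq_abs]
  refine (Complex.abs_re_le_norm _).trans ?_
  rw [norm_mul]
  have h1 := norm_shifted_inverse_entry_le hM.1 htri hlo hlt hmem ω (α ω) (R ω) (hα ω) (hR ω)
    N₁ k'.divNat t'.divNat hN₁
  have h2 := norm_shifted_inverse_entry_le hM.1 htri hlo hlt hmem (-ω) (α ω) (R ω)
    (by rw [hα, neg_sq]) (hR ω) N₂ k'.modNat t'.modNat hN₂
  refine (mul_le_mul h1 h2 (norm_nonneg _) ((norm_nonneg _).trans h1)).trans (le_of_eq ?_)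
  generalize lammax - lammin = d
  ring
end

section
/- Let M be an n×n real symmetric positive definite tridiagonal matrix with smallest eigenvalue λ_min and largest eigenvalue λ_max, λ_min < λ_max, and let S = M ⊗ I_n + I_n ⊗ M. For k, t ∈ {1, …, n²} set j = ⌊(t−1)/n⌋ + 1, i = t − n⌊(t−1)/n⌋, m = ⌊(k−1)/n⌋ + 1, ℓ = k − n⌊(k−1)/n⌋. For ω ∈ ℝ let α(ω) = (√(λ_min² + ω²) + √(λ_max² + ω²))/(λ_max − λ_min) and R(ω) = α(ω) + √(α(ω)² − 1). If exactly one of the equalities i = ℓ, j = m holds, then |(S⁻¹)_{k,t}| ≤ (1/(2π)) · (8/(λ_max − λ_min)) · ∫_{−∞}^{∞} (1/√(λ_min² + ω²)) · (R(ω)²/(R(ω)² − 1)²) · (1/R(ω))^{|i−ℓ| + |j−m| − 1} dω. -/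
open MeasureTheory Real Matrix

/-- The Chebyshev polynomial `T n` at a point in Joukowski form. -/
theorem eval_T_joukowski {w : ℂ} (hw : w ≠ 0) (n : ℤ) :
    (Polynomial.Chebyshev.T ℂ n).eval ((w + w⁻¹) / 2) = (w ^ n + (w ^ n)⁻¹) / 2 := by
  have h := Polynomial.Chebyshev.T_complex_cosh (Complex.log w) n
  rwa [Complex.cosh, Complex.cosh, Complex.exp_neg, Complex.exp_neg, Complex.exp_int_mul,
    Complex.exp_log hw] at h

theorem exists_joukowski (a : ℂ) :
    ∃ w : ℂ, 1 ≤ ‖w‖ ∧ a = (w + w⁻¹) / 2 ∧ ‖w‖ + ‖w‖⁻¹ = ‖a - 1‖ + ‖a + 1‖ := by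
  obtain ⟨s, hs⟩ := IsAlgClosed.exists_pow_nat_eq (a ^ 2 - 1) (n := 2) (by norm_num)
  have hprod : (a + s) * (a - s) = 1 := by linear_combination -hs
  obtain ⟨w, hw1, hw⟩ : ∃ w : ℂ, 1 ≤ ‖w‖ ∧ w ^ 2 - 2 * a * w + 1 = 0 := by
    by_cases h : 1 ≤ ‖a + s‖
    · exact ⟨a + s, h, by linear_combination hs⟩
    · refine ⟨a - s, ?_, by linear_combination hs⟩
      have hn : ‖a + s‖ * ‖a - s‖ = 1 := by rw [← norm_mul, hprod, norm_one]
      nlinarith [norm_nonneg (a - s), norm_nonneg (a + s)]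
  have hpos : 0 < ‖w‖ := by linarith
  have hw0 : w ≠ 0 := norm_pos_iff.mp hpos
  have ha : a = (w + w⁻¹) / 2 := by
    field_simp
    linear_combination -hw
  refine ⟨w, hw1, ha, ?_⟩
  have h1 : a - 1 = (w - 1) ^ 2 / (2 * w) := by rw [ha]; field_simp; ring
  have h2 : a + 1 = (w + 1) ^ 2 / (2 * w) := by rw [ha]; field_simp; ring
  have hpar := parallelogram_law_with_norm ℝ w 1
  rw [h1, h2, norm_div, norm_div, norm_pow, norm_pow, norm_mul, Complex.norm_ofNat]
  rw [norm_one] at hpar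
  field_simp
  linarith

theorem exists_norm_eq_one_joukowski {x : ℝ} (hx : x ∈ Set.Icc (-1 : ℝ) 1) :
    ∃ z : ℂ, ‖z‖ = 1 ∧ (x : ℂ) = (z + z⁻¹) / 2 := by
  refine ⟨Complex.exp (Real.arccos x * Complex.I), Complex.norm_exp_ofReal_mul_I _, ?_⟩
  rw [← Complex.exp_neg, ← neg_mul, ← Complex.cos, ← Complex.ofReal_cos,
    Real.cos_arccos hx.1 hx.2]

open Polynomial in
/-- The numerator of a near-best polynomial approximation of `1 / (x - a)` on `[-1, 1]`, where
`a = (w + w⁻¹) / 2`. -/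
noncomputable def nearBestNumerator (w : ℂ) (k : ℕ) : ℂ[X] :=
  C (w + star w) * Chebyshev.T ℂ k - C (w * star w) * Chebyshev.T ℂ (k + 1) -
    Chebyshev.T ℂ (k - 1)

theorem natDegree_nearBestNumerator_le (w : ℂ) (k : ℕ) :
    (nearBestNumerator w k).natDegree ≤ k + 1 := by
  unfold nearBestNumerator
  refine (Polynomial.natDegree_sub_le_of_le (Polynomial.natDegree_sub_le_of_le
    (Polynomial.natDegree_C_mul_le _ _) (Polynomial.natDegree_C_mul_le _ _)) le_rfl).trans ?_
  simp only [Polynomial.Chebyshev.natDegree_T]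
  omega

theorem eval_nearBestNumerator (w : ℂ) (k : ℕ) {z : ℂ} (hz : z ≠ 0) :
    (nearBestNumerator w k).eval ((z + z⁻¹) / 2) =
      (z ^ k * (1 - star w * z) * (w - z⁻¹) +
        (z ^ k)⁻¹ * (1 - star w * z⁻¹) * (w - z)) / 2 := by
  simp only [nearBestNumerator, Polynomial.eval_sub, Polynomial.eval_mul, Polynomial.eval_C,
    eval_T_joukowski hz, zpow_add₀ hz, zpow_sub₀ hz, zpow_natCast, zpow_one]
  field_simp
  ring

theorem norm_eval_nearBestNumerator_le {w : ℂ} (hw : w ≠ 0) (k : ℕ) {x : ℝ}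
    (hx : x ∈ Set.Icc (-1 : ℝ) 1) :
    ‖(nearBestNumerator w k).eval (x : ℂ)‖ ≤ 2 * ‖w‖ * ‖(x : ℂ) - (w + w⁻¹) / 2‖ := by
  obtain ⟨z, hz, hxz⟩ := exists_norm_eq_one_joukowski hx
  have hz0 : z ≠ 0 := by rintro rfl; simp at hz
  have hzc : z * star z = 1 := by
    rw [Complex.star_def, Complex.mul_conj, Complex.normSq_eq_norm_sq, hz]; simp
  have hinv : z⁻¹ = star z := inv_eq_of_mul_eq_one_right hzc
  have e1 : ‖1 - star w * z‖ = ‖w - z‖ := by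
    rw [← norm_star (w - z), star_sub, ← hinv, ← norm_neg]
    have : -(1 - star w * z) = (star w - z⁻¹) * z := by field_simp; ring
    rw [this, norm_mul, hz, mul_one]
  have e2 : ‖1 - star w * z⁻¹‖ = ‖w - z⁻¹‖ := by
    rw [← norm_star (w - z⁻¹), star_sub, hinv, star_star, ← hinv, ← norm_neg]
    have : -(1 - star w * z⁻¹) = (star w - z) * z⁻¹ := by field_simp; ring
    rw [this, norm_mul, norm_inv, hz, inv_one, mul_one]
  have e3 : ‖w - z‖ * ‖w - z⁻¹‖ = 2 * ‖w‖ * ‖(x : ℂ) - (w + w⁻¹) / 2‖ := by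
    have : (w - z) * (w - z⁻¹) = -(2 * w * ((x : ℂ) - (w + w⁻¹) / 2)) := by
      rw [hxz]; field_simp; ring
    rw [← norm_mul, this, norm_neg, norm_mul, norm_mul, Complex.norm_ofNat]
  rw [← e3, hxz, eval_nearBestNumerator w k hz0, norm_div, Complex.norm_ofNat,
    div_le_iff₀ two_pos]
  refine (norm_add_le _ _).trans_eq ?_
  simp only [norm_mul, norm_inv, norm_pow, hz, e1, e2, one_pow, inv_one, one_mul]
  ring

theorem le_norm_eval_nearBestNumerator {w : ℂ} (hw : 1 < ‖w‖) (k : ℕ) :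
    ‖w‖ ^ k * (‖w‖ ^ 2 - 1) ^ 2 / (2 * ‖w‖) ≤
      ‖(nearBestNumerator w k).eval ((w + w⁻¹) / 2)‖ := by
  have hpos : 0 < ‖w‖ := by linarith
  have hw0 : w ≠ 0 := norm_pos_iff.mp hpos
  have hsq : 0 < ‖w‖ ^ 2 - 1 := by nlinarith
  have h1 : ‖1 - star w * w‖ = ‖w‖ ^ 2 - 1 := by
    rw [Complex.star_def, ← Complex.normSq_eq_conj_mul_self, Complex.normSq_eq_norm_sq,
      ← norm_neg, neg_sub, ← Complex.ofReal_one, ← Complex.ofReal_sub, Complex.norm_real,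
      Real.norm_of_nonneg hsq.le]
  have h2 : (‖w‖ ^ 2 - 1) / ‖w‖ ≤ ‖w - w⁻¹‖ := by
    refine le_trans (le_of_eq ?_) (norm_sub_norm_le w w⁻¹)
    rw [norm_inv]; field_simp
  rw [eval_nearBestNumerator w k hw0, sub_self, mul_zero, add_zero, norm_div, norm_mul, norm_mul,
    h1, norm_pow, Complex.norm_ofNat]
  calc ‖w‖ ^ k * (‖w‖ ^ 2 - 1) ^ 2 / (2 * ‖w‖)
      = ‖w‖ ^ k * (‖w‖ ^ 2 - 1) * ((‖w‖ ^ 2 - 1) / ‖w‖) / 2 := by field_simp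
    _ ≤ _ := by gcongr

/-- Freund's bound for the polynomial approximation of `1 / (x - a)` on `[-1, 1]`, where `a` lies
on the ellipse with foci `±1` and sum of semi-axes `R`. -/
theorem exists_polynomial_approx_inv_sub_s1 (a : ℂ) {R : ℝ} (hR : 1 < R)
    (ha : R + R⁻¹ = ‖a - 1‖ + ‖a + 1‖) (k : ℕ) :
    ∃ Q : Polynomial ℂ, Q.natDegree ≤ k ∧ ∀ x ∈ Set.Icc (-1 : ℝ) 1,
      ‖((x : ℂ) - a)⁻¹ - Q.eval (x : ℂ)‖ ≤ 4 * (R ^ 2 / (R ^ 2 - 1) ^ 2) * (1 / R) ^ k := by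
  obtain ⟨w, hw1, haw, hw⟩ := exists_joukowski a
  have hwR : ‖w‖ = R := by
    have h : (‖w‖ - R) * (‖w‖ * R - 1) = 0 := by
      have h : ‖w‖ + ‖w‖⁻¹ = R + R⁻¹ := hw.trans ha.symm
      field_simp at h
      linarith
    rcases mul_eq_zero.mp h with h | h
    · linarith
    · nlinarith
  have hw0 : w ≠ 0 := norm_pos_iff.mp (by linarith)
  set P := nearBestNumerator w k
  have hPa : R ^ k * (R ^ 2 - 1) ^ 2 / (2 * R) ≤ ‖P.eval a‖ := by
    have h := le_norm_eval_nearBestNumerator (hwR ▸ hR) k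
    rwa [hwR, ← haw] at h
  have hsq : 0 < R ^ 2 - 1 := by nlinarith
  have hlow : 0 < R ^ k * (R ^ 2 - 1) ^ 2 / (2 * R) := by positivity
  have hPpos : 0 < ‖P.eval a‖ := hlow.trans_le hPa
  have hPa0 : P.eval a ≠ 0 := norm_pos_iff.mp hPpos
  set Q := P /ₘ (Polynomial.X - Polynomial.C a) with hQ
  have hdiv (y : ℂ) : P.eval y = P.eval a + (y - a) * Q.eval y := by
    conv_lhs => rw [← Polynomial.modByMonic_add_div P (Polynomial.X - Polynomial.C a)]
    simp [Polynomial.modByMonic_X_sub_C_eq_C_eval, hQ]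
  refine ⟨Polynomial.C (-(P.eval a)⁻¹) * Q, ?_, fun x hx => ?_⟩
  · refine (Polynomial.natDegree_C_mul_le _ _).trans ?_
    rw [hQ, Polynomial.natDegree_divByMonic _ (Polynomial.monic_X_sub_C a),
      Polynomial.natDegree_X_sub_C]
    exact Nat.sub_le_of_le_add (natDegree_nearBestNumerator_le w k)
  · have hxa : (x : ℂ) - a ≠ 0 := by
      intro h
      have hn := norm_eval_nearBestNumerator_le hw0 k hx
      rw [← haw, h, norm_zero, mul_zero, sub_eq_zero.mp h] at hn
      linarith
    have hxa' : 0 < ‖(x : ℂ) - a‖ := norm_pos_iff.mpr hxa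
    have hn : ‖P.eval (x : ℂ)‖ ≤ 2 * R * ‖(x : ℂ) - a‖ := by
      have h := norm_eval_nearBestNumerator_le hw0 k hx
      rwa [← haw, hwR] at h
    have herr : ((x : ℂ) - a)⁻¹ - (Polynomial.C (-(P.eval a)⁻¹) * Q).eval (x : ℂ) =
        P.eval (x : ℂ) / ((x - a) * P.eval a) := by
      rw [hdiv x, Polynomial.eval_mul, Polynomial.eval_C]
      field_simp
      ring
    rw [herr, norm_div, norm_mul]
    calc ‖P.eval (x : ℂ)‖ / (‖(x : ℂ) - a‖ * ‖P.eval a‖)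
        ≤ 2 * R * ‖(x : ℂ) - a‖ / (‖(x : ℂ) - a‖ * (R ^ k * (R ^ 2 - 1) ^ 2 / (2 * R))) := by
          gcongr
      _ = 4 * (R ^ 2 / (R ^ 2 - 1) ^ 2) * (1 / R) ^ k := by
          rw [one_div, inv_pow]
          field_simp
          ring

/-- A bound for a weighted sum of resolvents whose weights annihilate the powers up to `k`. -/
theorem norm_sum_div_add_mul_I_le {ι : Type*} [Fintype ι] (c μ : ι → ℝ) {p q : ℝ} (hpq : p < q)
    (hμ : ∀ s, μ s ∈ Set.Icc p q) (hc : ∑ s, |c s| ≤ 1) {k : ℕ}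
    (hk : ∀ r ≤ k, ∑ s, c s * μ s ^ r = 0) (ω : ℝ) {R : ℝ} (hR : 1 < R)
    (hRω : R + R⁻¹ = 2 * ((√(p ^ 2 + ω ^ 2) + √(q ^ 2 + ω ^ 2)) / (q - p))) :
    ‖∑ s, (c s : ℂ) / (μ s + ω * Complex.I)‖ ≤
      8 / (q - p) * (R ^ 2 / (R ^ 2 - 1) ^ 2 * (1 / R) ^ k) := by
  have hd : 0 < q - p := sub_pos.mpr hpq
  have hdC : ((q : ℂ) - p) ≠ 0 := by exact_mod_cast hd.ne'
  set a : ℂ := -(p + q + 2 * ω * Complex.I) / (q - p) with ha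
  have hnorm (u : ℝ) : ‖2 * ((u : ℂ) + ω * Complex.I) / ((q : ℂ) - p)‖ =
      2 * √(u ^ 2 + ω ^ 2) / (q - p) := by
    rw [norm_div, norm_mul, Complex.norm_ofNat, Complex.norm_add_mul_I, ← Complex.ofReal_sub,
      Complex.norm_real, Real.norm_of_nonneg hd.le]
  have h1 : ‖a - 1‖ = 2 * √(q ^ 2 + ω ^ 2) / (q - p) := by
    rw [← hnorm, ← norm_neg, ha]; congr 1; field_simp; ring
  have h2 : ‖a + 1‖ = 2 * √(p ^ 2 + ω ^ 2) / (q - p) := by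
    rw [← hnorm, ← norm_neg, ha]; congr 1; field_simp; ring
  obtain ⟨Q, hQdeg, hQ⟩ := exists_polynomial_approx_inv_sub_s1 a hR
    (by rw [hRω, h1, h2]; ring) k
  set x : ι → ℝ := fun s => (2 * μ s - (p + q)) / (q - p) with hx
  have hxmem (s : ι) : x s ∈ Set.Icc (-1 : ℝ) 1 := by
    obtain ⟨hl, hu⟩ := hμ s
    simp only [hx, Set.mem_Icc]
    rw [le_div_iff₀ hd, div_le_iff₀ hd]
    constructor <;> linarith
  set L : Polynomial ℂ := Q.comp (Polynomial.C (2 / ((q : ℂ) - p)) * Polynomial.X +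
    Polynomial.C (-(p + q) / ((q : ℂ) - p))) with hL
  have hLdeg : L.natDegree < k + 1 := by
    refine Nat.lt_succ_of_le (Polynomial.natDegree_comp_le.trans ?_)
    exact (Nat.mul_le_mul hQdeg Polynomial.natDegree_linear_le).trans_eq (mul_one k)
  have hLx (s : ι) : Q.eval (x s : ℂ) = L.eval (μ s : ℂ) := by
    rw [hL, Polynomial.eval_comp]
    congr 1
    simp [hx]
    ring
  have hzero : ∑ s, (c s : ℂ) * Q.eval (x s : ℂ) = 0 := by
    simp_rw [hLx, Polynomial.eval_eq_sum_range' hLdeg, Finset.mul_sum]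
    rw [Finset.sum_comm]
    refine Finset.sum_eq_zero fun r hr => ?_
    have h := hk r (Nat.lt_succ_iff.mp (Finset.mem_range.mp hr))
    calc ∑ s, (c s : ℂ) * (L.coeff r * (μ s : ℂ) ^ r)
        = L.coeff r * ((∑ s, c s * μ s ^ r : ℝ) : ℂ) := by
          push_cast
          rw [Finset.mul_sum]
          exact Finset.sum_congr rfl fun s _ => by ring
      _ = 0 := by rw [h]; simp
  have hterm (s : ι) : (c s : ℂ) / (μ s + ω * Complex.I) =
      2 / ((q : ℂ) - p) * ((c s : ℂ) * ((x s : ℂ) - a)⁻¹) := by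
    have h : (x s : ℂ) - a = 2 / ((q : ℂ) - p) * (μ s + ω * Complex.I) := by
      simp only [hx, ha]
      push_cast
      field_simp
      ring
    rw [h, mul_inv, div_eq_mul_inv]
    field_simp
  set B := 4 * (R ^ 2 / (R ^ 2 - 1) ^ 2) * (1 / R) ^ k with hB
  have hB0 : 0 ≤ B := by
    have : 0 < R := by linarith
    positivity
  have hsum : ‖∑ s, (c s : ℂ) * ((x s : ℂ) - a)⁻¹‖ ≤ B := by
    rw [← sub_zero (∑ s, _), ← hzero, ← Finset.sum_sub_distrib]
    simp_rw [← mul_sub]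
    calc _ ≤ ∑ s, |c s| * B := by
          refine norm_sum_le_of_le _ fun s _ => ?_
          rw [norm_mul, Complex.norm_real, Real.norm_eq_abs]
          exact mul_le_mul_of_nonneg_left (hQ _ (hxmem s)) (abs_nonneg _)
      _ ≤ B := by
          rw [← Finset.sum_mul]
          exact mul_le_of_le_one_left hB0 hc
  simp_rw [hterm]
  rw [← Finset.mul_sum, norm_mul, norm_div, Complex.norm_ofNat, ← Complex.ofReal_sub,
    Complex.norm_real, Real.norm_of_nonneg hd.le]
  calc 2 / (q - p) * ‖∑ s, (c s : ℂ) * ((x s : ℂ) - a)⁻¹‖ ≤ 2 / (q - p) * B := by gcongr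
    _ = _ := by rw [hB]; ring

theorem norm_sum_div_add_mul_I_le_inv_sqrt {ι : Type*} [Fintype ι] (c μ : ι → ℝ) {p : ℝ}
    (hp : 0 < p) (hμ : ∀ s, p ≤ μ s) (hc : ∑ s, |c s| ≤ 1) (ω : ℝ) :
    ‖∑ s, (c s : ℂ) / (μ s + ω * Complex.I)‖ ≤ 1 / √(p ^ 2 + ω ^ 2) := by
  calc _ ≤ ∑ s, |c s| * (1 / √(p ^ 2 + ω ^ 2)) := by
        refine norm_sum_le_of_le _ fun s _ => ?_
        rw [norm_div, Complex.norm_add_mul_I, Complex.norm_real, Real.norm_eq_abs,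
          div_eq_mul_one_div]
        have := hμ s
        gcongr
    _ ≤ _ := by
        rw [← Finset.sum_mul]
        exact mul_le_of_le_one_left (by positivity) hc

theorem integrable_inv_sq_add_sq {x : ℝ} (hx : 0 < x) :
    Integrable fun ω : ℝ => (x ^ 2 + ω ^ 2)⁻¹ := by
  have h := (integrable_inv_one_add_sq.comp_div hx.ne').const_mul ((x ^ 2)⁻¹)
  refine h.congr (Filter.Eventually.of_forall fun ω => ?_)
  simp only
  field_simp

theorem integral_univ_inv_sq_add_sq {x : ℝ} (hx : 0 < x) :
    ∫ ω : ℝ, (x ^ 2 + ω ^ 2)⁻¹ = π / x := by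
  have h (ω : ℝ) : (x ^ 2 + ω ^ 2)⁻¹ = (x ^ 2)⁻¹ * (1 + (ω / x) ^ 2)⁻¹ := by field_simp
  simp_rw [h]
  rw [integral_const_mul, Measure.integral_comp_div (fun ω : ℝ => (1 + ω ^ 2)⁻¹),
    integral_univ_inv_one_add_sq, abs_of_pos hx, smul_eq_mul]
  field_simp

theorem re_inv_mul_star_inv {x y : ℝ} (hx : 0 < x) (hy : 0 < y) (ω : ℝ) :
    (((x : ℂ) + ω * Complex.I)⁻¹ * star ((y : ℂ) + ω * Complex.I)⁻¹).re =
      (x + y)⁻¹ * (x * (x ^ 2 + ω ^ 2)⁻¹ + y * (y ^ 2 + ω ^ 2)⁻¹) := by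
  simp [Complex.normSq_apply, ← sq]
  field_simp
  ring

theorem integrable_re_inv_mul_star_inv {x y : ℝ} (hx : 0 < x) (hy : 0 < y) :
    Integrable fun ω : ℝ =>
      (((x : ℂ) + ω * Complex.I)⁻¹ * star ((y : ℂ) + ω * Complex.I)⁻¹).re := by
  simp_rw [re_inv_mul_star_inv hx hy]
  exact (((integrable_inv_sq_add_sq hx).const_mul x).add
    ((integrable_inv_sq_add_sq hy).const_mul y)).const_mul _

theorem integral_re_inv_mul_star_inv {x y : ℝ} (hx : 0 < x) (hy : 0 < y) :
    ∫ ω : ℝ, (((x : ℂ) + ω * Complex.I)⁻¹ * star ((y : ℂ) + ω * Complex.I)⁻¹).re =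
      2 * π / (x + y) := by
  simp_rw [re_inv_mul_star_inv hx hy]
  rw [integral_const_mul, integral_add ((integrable_inv_sq_add_sq hx).const_mul x)
    ((integrable_inv_sq_add_sq hy).const_mul y), integral_const_mul, integral_const_mul,
    integral_univ_inv_sq_add_sq hx, integral_univ_inv_sq_add_sq hy]
  field_simp
  ring

theorem integral_re_sum_mul_star_sum {ι : Type*} [Fintype ι] (c d μ : ι → ℝ)
    (hμ : ∀ s, 0 < μ s) :
    ∫ ω : ℝ, ((∑ s, (c s : ℂ) / (μ s + ω * Complex.I)) *
      star (∑ r, (d r : ℂ) / (μ r + ω * Complex.I))).re =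
      2 * π * ∑ s, ∑ r, c s * d r / (μ s + μ r) := by
  have h (ω : ℝ) : ((∑ s, (c s : ℂ) / (μ s + ω * Complex.I)) *
      star (∑ r, (d r : ℂ) / (μ r + ω * Complex.I))).re =
      ∑ s, ∑ r, c s * d r *
        (((μ s : ℂ) + ω * Complex.I)⁻¹ * star ((μ r : ℂ) + ω * Complex.I)⁻¹).re := by
    rw [star_sum, Finset.sum_mul_sum, Complex.re_sum]
    refine Finset.sum_congr rfl fun s _ => ?_
    rw [Complex.re_sum]
    refine Finset.sum_congr rfl fun r _ => ?_
    rw [← Complex.re_ofReal_mul, div_eq_mul_inv, div_eq_mul_inv, star_mul']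
    congr 1
    simp only [Complex.star_def, Complex.conj_ofReal, Complex.ofReal_mul]
    ring
  have hint (s r : ι) : Integrable fun ω : ℝ => c s * d r *
      (((μ s : ℂ) + ω * Complex.I)⁻¹ * star ((μ r : ℂ) + ω * Complex.I)⁻¹).re :=
    (integrable_re_inv_mul_star_inv (hμ s) (hμ r)).const_mul _
  simp_rw [h]
  rw [integral_finsetSum _ fun s _ => integrable_finsetSum _ fun r _ => hint s r, Finset.mul_sum]
  refine Finset.sum_congr rfl fun s _ => ?_
  rw [integral_finsetSum _ fun r _ => hint s r, Finset.mul_sum]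
  refine Finset.sum_congr rfl fun r _ => ?_
  rw [integral_const_mul, integral_re_inv_mul_star_inv (hμ s) (hμ r)]
  ring

theorem le_sqrt_add_sqrt_div_sq_sub_one {p q : ℝ} (hp : 0 < p) (hpq : p < q) (ω : ℝ) :
    4 * (p ^ 2 + ω ^ 2) / (q - p) ^ 2 ≤
      ((√(p ^ 2 + ω ^ 2) + √(q ^ 2 + ω ^ 2)) / (q - p)) ^ 2 - 1 := by
  have hd : 0 < q - p := sub_pos.mpr hpq
  have h1 : √(p ^ 2 + ω ^ 2) ^ 2 = p ^ 2 + ω ^ 2 := Real.sq_sqrt (by positivity)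
  have h2 : √(q ^ 2 + ω ^ 2) ^ 2 = q ^ 2 + ω ^ 2 := Real.sq_sqrt (by positivity)
  have h3 : p * q + ω ^ 2 ≤ √(p ^ 2 + ω ^ 2) * √(q ^ 2 + ω ^ 2) := by
    rw [← Real.sqrt_mul (by positivity)]
    exact Real.le_sqrt_of_sq_le (by nlinarith [sq_nonneg (ω * (p - q))])
  rw [div_pow, div_sub_one (by positivity)]
  gcongr
  nlinarith

theorem add_sqrt_sq_sub_one_add_inv {a : ℝ} (ha : 1 < a) :
    a + √(a ^ 2 - 1) + (a + √(a ^ 2 - 1))⁻¹ = 2 * a := by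
  have h : √(a ^ 2 - 1) ^ 2 = a ^ 2 - 1 := Real.sq_sqrt (by nlinarith)
  have hpos : 0 < a + √(a ^ 2 - 1) := by positivity
  field_simp
  linear_combination h

theorem sq_div_sq_sub_one_sq {a : ℝ} (ha : 1 < a) :
    (a + √(a ^ 2 - 1)) ^ 2 / ((a + √(a ^ 2 - 1)) ^ 2 - 1) ^ 2 = 1 / (4 * (a ^ 2 - 1)) := by
  have ha1 : 0 < a ^ 2 - 1 := by nlinarith
  have h : √(a ^ 2 - 1) ^ 2 = a ^ 2 - 1 := Real.sq_sqrt ha1.le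
  have hs : 0 < √(a ^ 2 - 1) := Real.sqrt_pos.mpr ha1
  have hden : (a + √(a ^ 2 - 1)) ^ 2 - 1 = 2 * √(a ^ 2 - 1) * (a + √(a ^ 2 - 1)) := by
    linear_combination -h
  have hpos : 0 < a + √(a ^ 2 - 1) := by positivity
  rw [hden, mul_pow, mul_pow, h]
  field_simp
  norm_num

section ResolventBound

variable {p q : ℝ} {α R : ℝ → ℝ}

theorem one_lt_sqrt_add_sqrt_div (hp : 0 < p) (hpq : p < q) (ω : ℝ) :
    1 < (√(p ^ 2 + ω ^ 2) + √(q ^ 2 + ω ^ 2)) / (q - p) := by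
  have hd : 0 < q - p := sub_pos.mpr hpq
  have h := le_sqrt_add_sqrt_div_sq_sub_one hp hpq ω
  have h' : 0 < 4 * (p ^ 2 + ω ^ 2) / (q - p) ^ 2 := by positivity
  exact (one_lt_sq_iff₀ (by positivity)).mp (by linarith)

theorem integrable_resolventBound (hp : 0 < p) (hpq : p < q)
    (hα : ∀ ω, α ω = (√(p ^ 2 + ω ^ 2) + √(q ^ 2 + ω ^ 2)) / (q - p))
    (hR : ∀ ω, R ω = α ω + √(α ω ^ 2 - 1)) (k : ℕ) :
    Integrable fun ω : ℝ => 1 / √(p ^ 2 + ω ^ 2) * (R ω ^ 2 / (R ω ^ 2 - 1) ^ 2) *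
      (1 / R ω) ^ k := by
  have hd : 0 < q - p := sub_pos.mpr hpq
  have hα1 (ω : ℝ) : 1 < α ω := hα ω ▸ one_lt_sqrt_add_sqrt_div hp hpq ω
  have hR1 (ω : ℝ) : 1 < R ω := by
    rw [hR]
    linarith [hα1 ω, Real.sqrt_nonneg (α ω ^ 2 - 1)]
  have hαm : Measurable α := by
    rw [funext hα]
    fun_prop
  have hRm : Measurable R := by
    rw [funext hR]
    fun_prop
  refine ((integrable_inv_sq_add_sq hp).const_mul (1 / p * ((q - p) ^ 2 / 16))).mono'
    (by fun_prop) (Filter.Eventually.of_forall fun ω => ?_)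
  have hRpos : 0 < R ω := by linarith [hR1 ω]
  rw [Real.norm_of_nonneg (by positivity)]
  have h1 : 1 / √(p ^ 2 + ω ^ 2) ≤ 1 / p := by
    gcongr
    exact Real.le_sqrt_of_sq_le (by nlinarith [sq_nonneg ω])
  have h2 : R ω ^ 2 / (R ω ^ 2 - 1) ^ 2 ≤ (q - p) ^ 2 / 16 * (p ^ 2 + ω ^ 2)⁻¹ := by
    rw [hR, sq_div_sq_sub_one_sq (hα1 ω)]
    calc 1 / (4 * (α ω ^ 2 - 1)) ≤ 1 / (4 * (4 * (p ^ 2 + ω ^ 2) / (q - p) ^ 2)) := by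
          gcongr
          rw [hα]
          exact le_sqrt_add_sqrt_div_sq_sub_one hp hpq ω
      _ = _ := by field_simp; norm_num
  have h3 : (1 / R ω) ^ k ≤ 1 := by
    apply pow_le_one₀ (by positivity)
    rw [div_le_one hRpos]
    exact (hR1 ω).le
  calc _ ≤ 1 / p * ((q - p) ^ 2 / 16 * (p ^ 2 + ω ^ 2)⁻¹) * 1 := by gcongr
    _ = _ := by ring

theorem abs_sum_sum_div_add_le {ι : Type*} [Fintype ι] (c d μ : ι → ℝ) (hp : 0 < p) (hpq : p < q)
    (hα : ∀ ω, α ω = (√(p ^ 2 + ω ^ 2) + √(q ^ 2 + ω ^ 2)) / (q - p))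
    (hR : ∀ ω, R ω = α ω + √(α ω ^ 2 - 1))
    (hμ : ∀ s, μ s ∈ Set.Icc p q) (hc : ∑ s, |c s| ≤ 1) (hd : ∑ s, |d s| ≤ 1) {k : ℕ}
    (hk : ∀ r ≤ k, ∑ s, c s * μ s ^ r = 0) :
    |∑ s, ∑ r, c s * d r / (μ s + μ r)| ≤ 1 / (2 * π) * (8 / (q - p)) *
      ∫ ω : ℝ, 1 / √(p ^ 2 + ω ^ 2) * (R ω ^ 2 / (R ω ^ 2 - 1) ^ 2) * (1 / R ω) ^ k := by
  have hα1 (ω : ℝ) : 1 < α ω := hα ω ▸ one_lt_sqrt_add_sqrt_div hp hpq ω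
  have hR1 (ω : ℝ) : 1 < R ω := by
    rw [hR]
    linarith [hα1 ω, Real.sqrt_nonneg (α ω ^ 2 - 1)]
  have hRα (ω : ℝ) : R ω + (R ω)⁻¹ = 2 * ((√(p ^ 2 + ω ^ 2) + √(q ^ 2 + ω ^ 2)) / (q - p)) := by
    rw [hR, add_sqrt_sq_sub_one_add_inv (hα1 ω), hα]
  have hrep := integral_re_sum_mul_star_sum c d μ fun s => hp.trans_le (hμ s).1
  have hval : ∑ s, ∑ r, c s * d r / (μ s + μ r) = 1 / (2 * π) *
      ∫ ω : ℝ, ((∑ s, (c s : ℂ) / (μ s + ω * Complex.I)) *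
        star (∑ r, (d r : ℂ) / (μ r + ω * Complex.I))).re := by
    rw [hrep]
    field_simp
  rw [hval, abs_mul, abs_of_pos (by positivity : 0 < 1 / (2 * π)), mul_assoc,
    ← integral_const_mul, ← Real.norm_eq_abs]
  refine mul_le_mul_of_nonneg_left ?_ (by positivity)
  refine norm_integral_le_of_norm_le ((integrable_resolventBound hp hpq hα hR k).const_mul _)
    (Filter.Eventually.of_forall fun ω => ?_)
  refine (Complex.abs_re_le_norm _).trans ?_
  rw [norm_mul, norm_star]
  have h1 := norm_sum_div_add_mul_I_le c μ hpq hμ hc hk ω (hR1 ω) (hRα ω)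
  have h2 := norm_sum_div_add_mul_I_le_inv_sqrt d μ hp (fun s => (hμ s).1) hd ω
  refine (mul_le_mul h1 h2 (norm_nonneg _) ((norm_nonneg _).trans h1)).trans_eq ?_
  ring

end ResolventBound

theorem pow_apply_eq_zero_of_tridiagonal {n : ℕ} {M : Matrix (Fin n) (Fin n) ℝ}
    (htri : ∀ a c : Fin n, 1 < |(a : ℤ) - (c : ℤ)| → M a c = 0) (r : ℕ) :
    ∀ a c : Fin n, (r : ℤ) < |(a : ℤ) - (c : ℤ)| → (M ^ r) a c = 0 := by
  induction r with
  | zero =>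
    intro a c h
    rw [pow_zero, Matrix.one_apply_ne]
    rintro rfl
    simp at h
  | succ r ih =>
    intro a c h
    rw [pow_succ, Matrix.mul_apply]
    refine Finset.sum_eq_zero fun b _ => ?_
    by_cases hb : (r : ℤ) < |(a : ℤ) - (b : ℤ)|
    · rw [ih a b hb, zero_mul]
    · rw [htri b c, mul_zero]
      push_cast at h
      have := abs_sub_le (a : ℤ) b c
      omega

section EigenDecomposition

variable {n : ℕ} {M U : Matrix (Fin n) (Fin n) ℝ} {μ : Fin n → ℝ}

theorem pow_apply_eq_sum_eigen (hU : U * Uᵀ = 1) (hMU : M * U = U * Matrix.diagonal μ) (r : ℕ)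
    (a b : Fin n) : (M ^ r) a b = ∑ s, U a s * U b s * μ s ^ r := by
  have h : M ^ r * U = U * Matrix.diagonal μ ^ r := by
    induction r with
    | zero => simp
    | succ r ih => rw [pow_succ, Matrix.mul_assoc, hMU, ← Matrix.mul_assoc, ih, pow_succ,
        Matrix.mul_assoc]
  have h' : M ^ r = U * Matrix.diagonal μ ^ r * Uᵀ := by
    rw [← h, Matrix.mul_assoc, hU, Matrix.mul_one]
  rw [h', Matrix.diagonal_pow, Matrix.mul_apply]
  refine Finset.sum_congr rfl fun s _ => ?_
  rw [Matrix.mul_diagonal, Matrix.transpose_apply, Pi.pow_apply]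
  ring

theorem sum_abs_mul_le_one (hU : U * Uᵀ = 1) (a b : Fin n) : ∑ s, |U a s * U b s| ≤ 1 := by
  have h (a : Fin n) : ∑ s, U a s ^ 2 = 1 := by
    have h := congrFun (congrFun hU a) a
    rw [Matrix.mul_apply, Matrix.one_apply_eq] at h
    simpa only [Matrix.transpose_apply, ← sq] using h
  calc ∑ s, |U a s * U b s| ≤ ∑ s, (U a s ^ 2 + U b s ^ 2) / 2 := by
        refine Finset.sum_le_sum fun s _ => ?_
        rw [abs_mul]
        nlinarith [sq_nonneg (|U a s| - |U b s|), sq_abs (U a s), sq_abs (U b s)]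
    _ = 1 := by rw [← Finset.sum_div, Finset.sum_add_distrib, h, h]; norm_num

theorem kronSum_apply_finProdFinEquiv (M : Matrix (Fin n) (Fin n) ℝ) (x y : Fin n × Fin n) :
    kronSum n M (finProdFinEquiv x) (finProdFinEquiv y) =
      (if x.1 = y.1 then M x.2 y.2 else 0) + (if x.2 = y.2 then M x.1 y.1 else 0) := by
  have hn : 0 < n := x.1.pos
  have hdiv (z : Fin n × Fin n) : ((finProdFinEquiv z : Fin (n * n)) : ℕ) / n = z.1 := by
    rw [finProdFinEquiv_apply_val, Nat.add_mul_div_left _ _ hn, Nat.div_eq_of_lt z.2.2, zero_add]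
  have hmod (z : Fin n × Fin n) : ((finProdFinEquiv z : Fin (n * n)) : ℕ) % n = z.2 := by
    rw [finProdFinEquiv_apply_val, Nat.add_mul_mod_self_left, Nat.mod_eq_of_lt z.2.2]
  simp only [kronSum, hdiv, hmod, Fin.eta, Fin.ext_iff]

theorem kronSum_inv_apply_s1 (hU : U * Uᵀ = 1) (hMU : M * U = U * Matrix.diagonal μ)
    (hμ : ∀ s, 0 < μ s) (x y : Fin n × Fin n) :
    (kronSum n M)⁻¹ (finProdFinEquiv x) (finProdFinEquiv y) =
      ∑ s, ∑ r, U x.2 s * U y.2 s * (U x.1 r * U y.1 r) / (μ s + μ r) := by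
  set N : Matrix (Fin n × Fin n) (Fin n × Fin n) ℝ := fun x y =>
    ∑ s, ∑ r, U x.2 s * U y.2 s * (U x.1 r * U y.1 r) / (μ s + μ r) with hN
  set S := (kronSum n M).submatrix finProdFinEquiv finProdFinEquiv with hS
  have hM (a s : Fin n) : ∑ b, M a b * U b s = U a s * μ s := by
    have h := congrFun (congrFun hMU a) s
    rwa [Matrix.mul_apply, Matrix.mul_diagonal] at h
  have hUU (a b : Fin n) : ∑ s, U a s * U b s = if a = b then 1 else 0 := by
    have h := congrFun (congrFun hU a) b
    rwa [Matrix.mul_apply, Matrix.one_apply] at h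
  have hSN : S * N = 1 := by
    ext x z
    have h1 : ∑ b, M x.2 b * N (x.1, b) z =
        ∑ s, ∑ r, U x.2 s * μ s * U z.2 s * (U x.1 r * U z.1 r) / (μ s + μ r) := by
      simp only [hN, Finset.mul_sum]
      rw [Finset.sum_comm]
      refine Finset.sum_congr rfl fun s _ => ?_
      rw [Finset.sum_comm]
      refine Finset.sum_congr rfl fun r _ => ?_
      rw [← hM, Finset.sum_mul, Finset.sum_mul, Finset.sum_div]
      exact Finset.sum_congr rfl fun b _ => by ring
    have h2 : ∑ b, M x.1 b * N (b, x.2) z =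
        ∑ s, ∑ r, U x.2 s * U z.2 s * (U x.1 r * μ r * U z.1 r) / (μ s + μ r) := by
      simp only [hN, Finset.mul_sum]
      rw [Finset.sum_comm]
      refine Finset.sum_congr rfl fun s _ => ?_
      rw [Finset.sum_comm]
      refine Finset.sum_congr rfl fun r _ => ?_
      rw [← hM, Finset.sum_mul, Finset.mul_sum, Finset.sum_div]
      exact Finset.sum_congr rfl fun b _ => by ring
    have h3 : (S * N) x z = ∑ b, M x.2 b * N (x.1, b) z + ∑ b, M x.1 b * N (b, x.2) z := by
      simp only [Matrix.mul_apply, hS, Matrix.submatrix_apply, kronSum_apply_finProdFinEquiv,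
        add_mul, Finset.sum_add_distrib, ite_mul, zero_mul]
      congr 1
      · simp [Fintype.sum_prod_type]
      · simp [Fintype.sum_prod_type]
    rw [h3, h1, h2, ← Finset.sum_add_distrib]
    calc _ = ∑ s, ∑ r, U x.2 s * U z.2 s * (U x.1 r * U z.1 r) := by
          refine Finset.sum_congr rfl fun s _ => ?_
          rw [← Finset.sum_add_distrib]
          refine Finset.sum_congr rfl fun r _ => ?_
          have := hμ s
          have := hμ r
          field_simp
      _ = _ := by
          rw [← Finset.sum_mul_sum, hUU, hUU, Matrix.one_apply]
          simp only [Prod.ext_iff]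
          split_ifs <;> simp_all
  have hinv : S⁻¹ = N := Matrix.inv_eq_right_inv hSN
  rw [hS, Matrix.inv_submatrix_equiv] at hinv
  exact congrFun (congrFun hinv x) y

end EigenDecomposition

/-- The integral bound for the entries of `S⁻¹` when the distance in one of the two grid directions
exceeds `k`. -/
theorem abs_kronSum_inv_apply_le {n : ℕ} {M : Matrix (Fin n) (Fin n) ℝ} (hM : M.PosDef)
    (htri : ∀ a c : Fin n, 1 < |(a : ℤ) - (c : ℤ)| → M a c = 0) {p q : ℝ}
    (hmin : IsLeast (Set.range hM.1.eigenvalues) p)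
    (hmax : IsGreatest (Set.range hM.1.eigenvalues) q) (hpq : p < q) {α R : ℝ → ℝ}
    (hα : ∀ ω, α ω = (√(p ^ 2 + ω ^ 2) + √(q ^ 2 + ω ^ 2)) / (q - p))
    (hR : ∀ ω, R ω = α ω + √(α ω ^ 2 - 1)) (x y : Fin n × Fin n) {k : ℕ}
    (hk : (k : ℤ) < |(x.2 : ℤ) - (y.2 : ℤ)| ∨ (k : ℤ) < |(x.1 : ℤ) - (y.1 : ℤ)|) :
    |(kronSum n M)⁻¹ (finProdFinEquiv x) (finProdFinEquiv y)| ≤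
      1 / (2 * π) * (8 / (q - p)) *
      ∫ ω : ℝ, 1 / √(p ^ 2 + ω ^ 2) * (R ω ^ 2 / (R ω ^ 2 - 1) ^ 2) * (1 / R ω) ^ k := by
  set μ := hM.1.eigenvalues
  set U : Matrix (Fin n) (Fin n) ℝ := ↑hM.1.eigenvectorUnitary
  have hU : U * Uᵀ = 1 := by
    have h := Matrix.mem_unitaryGroup_iff.mp hM.1.eigenvectorUnitary.2
    rwa [Matrix.star_eq_conjTranspose, Matrix.conjTranspose_eq_transpose_of_trivial] at h
  have hMU : M * U = U * Matrix.diagonal μ := by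
    ext a s
    have h := congrFun (hM.1.mulVec_eigenvectorBasis s) a
    rw [Matrix.mul_diagonal, mul_comm (U a s)]
    exact h
  have hμpos (s : Fin n) : 0 < μ s := hM.eigenvalues_pos s
  have hp : 0 < p := by
    obtain ⟨s, hs⟩ := hmin.1
    exact hs ▸ hμpos s
  have hμ (s : Fin n) : μ s ∈ Set.Icc p q := ⟨hmin.2 ⟨s, rfl⟩, hmax.2 ⟨s, rfl⟩⟩
  have hzero {a b : Fin n} (h : (k : ℤ) < |(a : ℤ) - (b : ℤ)|) (r : ℕ) (hr : r ≤ k) :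
      ∑ s, U a s * U b s * μ s ^ r = 0 := by
    rw [← pow_apply_eq_sum_eigen hU hMU]
    exact pow_apply_eq_zero_of_tridiagonal htri r a b (by omega)
  rw [kronSum_inv_apply_s1 hU hMU hμpos]
  rcases hk with hk | hk
  · exact abs_sum_sum_div_add_le _ _ μ hp hpq hα hR hμ (sum_abs_mul_le_one hU _ _)
      (sum_abs_mul_le_one hU _ _) (hzero hk)
  · rw [Finset.sum_comm]
    have h := abs_sum_sum_div_add_le _ _ μ hp hpq hα hR hμ (sum_abs_mul_le_one hU x.1 y.1)
      (sum_abs_mul_le_one hU x.2 y.2) (hzero hk)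
    refine le_of_eq_of_le ?_ h
    congr 1
    refine Finset.sum_congr rfl fun r _ => Finset.sum_congr rfl fun s _ => ?_
    rw [mul_comm (U x.2 s * U y.2 s), add_comm]

/-- Proposition 2.2 (ii): integral bound for the entries of `S⁻¹` when exactly
one of the two grid coordinates coincides (`M` tridiagonal SPD). -/
theorem kronSum_inv_entry_integral_bound_oneEqual
    (n : ℕ) (M : Matrix (Fin n) (Fin n) ℝ) (hM : M.PosDef)
    (htri : ∀ a c : Fin n, 1 < |(a : ℤ) - (c : ℤ)| → M a c = 0)
    (lammin lammax : ℝ)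
    (hmin : IsLeast (Set.range hM.1.eigenvalues) lammin)
    (hmax : IsGreatest (Set.range hM.1.eigenvalues) lammax)
    (hlt : lammin < lammax)
    (k t : ℕ) (hk1 : 1 ≤ k) (hk2 : k ≤ n * n) (ht1 : 1 ≤ t) (ht2 : t ≤ n * n)
    (i j ℓ m : ℕ)
    (hj : j = (t - 1) / n + 1) (hi : i = t - n * ((t - 1) / n))
    (hm : m = (k - 1) / n + 1) (hl : ℓ = k - n * ((k - 1) / n))
    (hone : (i = ℓ ∧ j ≠ m) ∨ (i ≠ ℓ ∧ j = m))
    (α R : ℝ → ℝ)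
    (hα : ∀ ω : ℝ, α ω =
      (Real.sqrt (lammin ^ 2 + ω ^ 2) + Real.sqrt (lammax ^ 2 + ω ^ 2)) / (lammax - lammin))
    (hR : ∀ ω : ℝ, R ω = α ω + Real.sqrt (α ω ^ 2 - 1)) :
    |(kronSum n M)⁻¹ ⟨k - 1, by omega⟩ ⟨t - 1, by omega⟩| ≤
      (1 / (2 * Real.pi)) * (8 / (lammax - lammin)) *
        ∫ ω : ℝ, (1 / Real.sqrt (lammin ^ 2 + ω ^ 2)) *
          (R ω ^ 2 / (R ω ^ 2 - 1) ^ 2) *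
          (1 / R ω) ^ (|(i : ℝ) - (ℓ : ℝ)| + |(j : ℝ) - (m : ℝ)| - 1) := by
  have hn : 0 < n := by
    rcases Nat.eq_zero_or_pos n with h | h
    · subst h
      omega
    · exact h
  have hk' : k - 1 < n * n := by omega
  have ht' : t - 1 < n * n := by omega
  have hkd := Nat.mod_add_div (k - 1) n
  have htd := Nat.mod_add_div (t - 1) n
  set x : Fin n × Fin n :=
    (⟨(k - 1) / n, Nat.div_lt_of_lt_mul hk'⟩, ⟨(k - 1) % n, Nat.mod_lt _ hn⟩) with hx
  set y : Fin n × Fin n :=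
    (⟨(t - 1) / n, Nat.div_lt_of_lt_mul ht'⟩, ⟨(t - 1) % n, Nat.mod_lt _ hn⟩) with hy
  have hxk : (⟨k - 1, hk'⟩ : Fin (n * n)) = finProdFinEquiv x := Fin.ext hkd.symm
  have hyt : (⟨t - 1, ht'⟩ : Fin (n * n)) = finProdFinEquiv y := Fin.ext htd.symm
  have hj' : j = (y.1 : ℕ) + 1 := hj
  have hm' : m = (x.1 : ℕ) + 1 := hm
  have hi' : i = (y.2 : ℕ) + 1 := by simp only [hy]; omega
  have hl' : ℓ = (x.2 : ℕ) + 1 := by simp only [hx]; omega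
  obtain ⟨e, he, hcase⟩ : ∃ e : ℕ, |(i : ℤ) - ℓ| + |(j : ℤ) - m| - 1 = e ∧
      ((e : ℤ) < |(x.2 : ℤ) - (y.2 : ℤ)| ∨ (e : ℤ) < |(x.1 : ℤ) - (y.1 : ℤ)|) := by
    subst hi' hj' hl' hm'
    push_cast
    simp only [add_sub_add_right_eq_sub]
    rcases hone with ⟨h, h'⟩ | ⟨h, h'⟩
    · have h0 : |(y.2 : ℤ) - x.2| = 0 := by rw [abs_eq_zero]; omega
      have h1 : 0 < |(y.1 : ℤ) - x.1| := abs_pos.mpr (by omega)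
      rw [h0, abs_sub_comm (x.1 : ℤ)]
      exact ⟨(|(y.1 : ℤ) - x.1| - 1).toNat, by omega, Or.inr (by omega)⟩
    · have h0 : |(y.1 : ℤ) - x.1| = 0 := by rw [abs_eq_zero]; omega
      have h1 : 0 < |(y.2 : ℤ) - x.2| := abs_pos.mpr (by omega)
      rw [h0, abs_sub_comm (x.2 : ℤ)]
      exact ⟨(|(y.2 : ℤ) - x.2| - 1).toNat, by omega, Or.inl (by omega)⟩
  have hexp : |(i : ℝ) - (ℓ : ℝ)| + |(j : ℝ) - (m : ℝ)| - 1 = (e : ℝ) := by exact_mod_cast he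
  rw [hxk, hyt, hexp]
  simp_rw [Real.rpow_natCast]
  exact abs_kronSum_inv_apply_le hM htri hmin hmax hlt hα hR x y hcase
end

section
/- Let M be an n×n real symmetric positive definite tridiagonal matrix with smallest eigenvalue λ_min and largest eigenvalue λ_max, λ_min < λ_max, and let S = M ⊗ I_n + I_n ⊗ M. For k, t ∈ {1, …, n²} set j = ⌊(t−1)/n⌋ + 1, i = t − n⌊(t−1)/n⌋, m = ⌊(k−1)/n⌋ + 1, ℓ = k − n⌊(k−1)/n⌋, and let 𝔫₂ = |ℓ − i| + |m − j| − 2. If ℓ ≠ i, m ≠ j and 𝔫₂ > 0, then |(S⁻¹)_{k,t}| ≤ (1/(2√2)) · ((λ_max − λ_min)^{𝔫₂+2} / (λ_max² + λ_min²)^{𝔫₂/2}) · (√(λ_max² + λ_min²) / (λ_max λ_min)²) · (1/√𝔫₂) · √(2𝔫₂/(𝔫₂ + 4)). -/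
open MeasureTheory Real Matrix

open Kronecker in
/-- `kronSum` is the Kronecker sum `M ⊗ 1 + 1 ⊗ M` reindexed along `finProdFinEquiv`. -/
theorem kronSum_eq_submatrix (n : ℕ) (M : Matrix (Fin n) (Fin n) ℝ) :
    kronSum n M =
      (M ⊗ₖ (1 : Matrix (Fin n) (Fin n) ℝ) + (1 : Matrix (Fin n) (Fin n) ℝ) ⊗ₖ M).submatrix
        (finProdFinEquiv (m := n) (n := n)).symm finProdFinEquiv.symm := by
  ext k t
  simp only [kronSum, submatrix_apply, finProdFinEquiv_symm_apply, Matrix.add_apply,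
    kronecker_apply, one_apply, Fin.ext_iff, Fin.coe_divNat, Fin.coe_modNat, mul_ite, mul_one,
    mul_zero, ite_mul, one_mul, zero_mul]
  rw [add_comm]
  rfl

/-- Spectral theorem for a real symmetric matrix, with an explicit orthogonal factor. -/
theorem Matrix.IsHermitian.exists_orthogonal_diagonalization {ι : Type*} [Fintype ι]
    [DecidableEq ι] {A : Matrix ι ι ℝ} (hA : A.IsHermitian) :
    ∃ U : Matrix ι ι ℝ, U * Uᵀ = 1 ∧ A = U * diagonal hA.eigenvalues * Uᵀ := by
  refine ⟨hA.eigenvectorUnitary, ?_, ?_⟩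
  · simpa [star_eq_conjTranspose] using Unitary.mul_star_self_of_mem hA.eigenvectorUnitary.2
  · have h := hA.spectral_theorem
    rw [Unitary.conjStarAlgAut_apply] at h
    simpa [star_eq_conjTranspose, Function.comp_def] using h

theorem mul_diagonal_mul_transpose_mul {ι : Type*} [Fintype ι] [DecidableEq ι]
    {W : Matrix ι ι ℝ} (hW : W * Wᵀ = 1) (f g : ι → ℝ) :
    W * diagonal f * Wᵀ * (W * diagonal g * Wᵀ) = W * diagonal (f * g) * Wᵀ := by
  have hW' : Wᵀ * W = 1 := mul_eq_one_comm.mp hW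
  calc _ = W * diagonal f * (Wᵀ * W) * diagonal g * Wᵀ := by simp only [Matrix.mul_assoc]
    _ = _ := by
      rw [hW', Matrix.mul_one, Matrix.mul_assoc W, diagonal_mul_diagonal]; rfl

theorem mul_diagonal_mul_transpose_pow {ι : Type*} [Fintype ι] [DecidableEq ι]
    {W : Matrix ι ι ℝ} (hW : W * Wᵀ = 1) (f : ι → ℝ) (p : ℕ) :
    (W * diagonal f * Wᵀ) ^ p = W * diagonal (f ^ p) * Wᵀ := by
  induction p with
  | zero => simp [hW]
  | succ p ih => rw [pow_succ, ih, mul_diagonal_mul_transpose_mul hW, pow_succ]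

theorem abs_mul_diagonal_mul_transpose_le {ι : Type*} [Fintype ι] [DecidableEq ι]
    {W : Matrix ι ι ℝ} (hW : W * Wᵀ = 1) {f : ι → ℝ} {C : ℝ} (hf : ∀ p, |f p| ≤ C) (k t : ι) :
    |(W * diagonal f * Wᵀ) k t| ≤ C := by
  have hrow : ∀ q, ∑ p, W q p ^ 2 = 1 := fun q => by
    simpa [mul_apply, sq] using congr_fun (congr_fun hW q) q
  calc |(W * diagonal f * Wᵀ) k t| = |∑ p, W k p * f p * W t p| := by
        simp only [mul_apply (M := W * diagonal f), mul_diagonal, transpose_apply]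
    _ ≤ ∑ p, |W k p * f p * W t p| := Finset.abs_sum_le_sum_abs _ _
    _ ≤ ∑ p, C * ((W k p ^ 2 + W t p ^ 2) / 2) := by
        refine Finset.sum_le_sum fun p _ => ?_
        have hC : 0 ≤ C := (abs_nonneg _).trans (hf p)
        rw [abs_mul, abs_mul, mul_comm |W k p|, mul_assoc]
        refine mul_le_mul (hf p) ?_ (by positivity) hC
        nlinarith [sq_nonneg (|W k p| - |W t p|), sq_abs (W k p), sq_abs (W t p)]
    _ = C := by
        rw [← Finset.mul_sum, ← Finset.sum_div, Finset.sum_add_distrib, hrow, hrow]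
        ring

/-- Powers of a matrix of bandwidth one, with respect to a discrete distance, gain at most one
unit of bandwidth per factor. -/
theorem pow_apply_eq_zero_of_banded {ι : Type*} [Fintype ι] [DecidableEq ι] {B : Matrix ι ι ℝ}
    {d : ι → ι → ℕ} (hself : ∀ x, d x x = 0) (htri : ∀ x y z, d x z ≤ d x y + d y z)
    (hB : ∀ x y, 1 < d x y → B x y = 0) (p : ℕ) (k t : ι) (hp : p < d k t) :
    (B ^ p) k t = 0 := by
  induction p generalizing t with
  | zero =>
    rw [pow_zero, one_apply_ne]
    rintro rfl
    simp [hself] at hp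
  | succ p ih =>
    rw [pow_succ, mul_apply]
    refine Finset.sum_eq_zero fun s _ => ?_
    by_cases hs : p < d k s
    · rw [ih s hs, zero_mul]
    · rw [hB s t (by have := htri k s t; omega), mul_zero]

/-- Exponential off-diagonal decay of the inverse of a positive definite banded matrix, obtained
from the Neumann series of `1 - (2 / (α + β)) • S`. -/
theorem abs_inv_apply_le_of_banded {ι : Type*} [Fintype ι] [DecidableEq ι] {S W : Matrix ι ι ℝ}
    {μ : ι → ℝ} (hW : W * Wᵀ = 1) (hS : S = W * diagonal μ * Wᵀ) {α β : ℝ} (hα : 0 < α)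
    (hμα : ∀ p, α ≤ μ p) (hμβ : ∀ p, μ p ≤ β)
    {d : ι → ι → ℕ} (hself : ∀ x, d x x = 0) (htri : ∀ x y z, d x z ≤ d x y + d y z)
    (hband : ∀ x y, 1 < d x y → S x y = 0) (k t : ι) :
    |S⁻¹ k t| ≤ ((β - α) / (β + α)) ^ d k t / α := by
  set c : ℝ := 2 / (β + α) with hc
  have hβ : α ≤ β := (hμα k).trans (hμβ k)
  have hμ : ∀ p, μ p ≠ 0 := fun p => (hα.trans_le (hμα p)).ne'
  have hright : S * (W * diagonal μ⁻¹ * Wᵀ) = 1 := by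
    rw [hS, mul_diagonal_mul_transpose_mul hW]
    have : μ * μ⁻¹ = fun _ => 1 := funext fun p => mul_inv_cancel₀ (hμ p)
    rw [this, diagonal_one, Matrix.mul_one, hW]
  have hinv : S⁻¹ = W * diagonal μ⁻¹ * Wᵀ := inv_eq_right_inv hright
  have hB : 1 - c • S = W * diagonal (fun p => 1 - c * μ p) * Wᵀ := by
    have : diagonal (fun p => 1 - c * μ p) = 1 - c • diagonal μ := by
      rw [← diagonal_one, ← diagonal_smul, diagonal_sub]; rfl
    rw [this, Matrix.mul_sub, Matrix.sub_mul, Matrix.mul_one, hW, hS]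
    simp
  have hBband : ∀ x y, 1 < d x y → (1 - c • S) x y = 0 := fun x y hxy => by
    have hne : x ≠ y := by
      rintro rfl
      simp [hself] at hxy
    simp [hband x y hxy, one_apply_ne hne]
  have hgeom : c • ∑ p ∈ Finset.range (d k t), (1 - c • S) ^ p
      = S⁻¹ - (1 - c • S) ^ d k t * S⁻¹ := by
    have h := congrArg (· * S⁻¹) (geom_sum_mul_neg (1 - c • S) (d k t))
    simp only [sub_sub_cancel, Matrix.sub_mul, Matrix.one_mul, Matrix.mul_assoc] at h
    rw [← h, Matrix.smul_mul, hinv, hright, Matrix.mul_smul, Matrix.mul_one]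
  have hzero : (c • ∑ p ∈ Finset.range (d k t), (1 - c • S) ^ p) k t = 0 := by
    rw [Matrix.smul_apply, Matrix.sum_apply, Finset.sum_eq_zero, smul_zero]
    exact fun p hp => pow_apply_eq_zero_of_banded hself htri hBband p k t (Finset.mem_range.mp hp)
  have hentry : S⁻¹ k t = ((1 - c • S) ^ d k t * S⁻¹) k t := by
    rw [hgeom, Matrix.sub_apply] at hzero
    linarith
  rw [hentry, hB, hinv, mul_diagonal_mul_transpose_pow hW, mul_diagonal_mul_transpose_mul hW]
  refine abs_mul_diagonal_mul_transpose_le hW (fun p => ?_) k t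
  have hp := hμα p
  have hp' := hμβ p
  have hs : 0 < β + α := by linarith
  have h1 : |1 - c * μ p| ≤ (β - α) / (β + α) := by
    have : 1 - c * μ p = (β + α - 2 * μ p) / (β + α) := by rw [hc]; field_simp
    rw [this, abs_div, abs_of_pos hs]
    gcongr
    rw [abs_le]
    constructor <;> linarith
  rw [Pi.mul_apply, Pi.pow_apply, Pi.inv_apply, abs_mul, abs_pow, abs_inv,
    abs_of_pos (hα.trans_le hp), div_eq_mul_inv]
  have := hα.trans_le hp
  gcongr

theorem decay_le_explicit_bound {a b : ℝ} (ha : 0 < a) (hab : a < b) (N : ℕ) (hN : 0 < N) :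
    ((2 * b - 2 * a) / (2 * b + 2 * a)) ^ (N + 2) / (2 * a) ≤
      (1 / (2 * √2)) * ((b - a) ^ ((N : ℝ) + 2) / (b ^ 2 + a ^ 2) ^ ((N : ℝ) / 2)) *
        (√(b ^ 2 + a ^ 2) / (b * a) ^ 2) * (1 / √(N : ℝ)) * √(2 * (N : ℝ) / ((N : ℝ) + 4)) := by
  have hb : 0 < b := ha.trans hab
  have hba : 0 < b - a := sub_pos.mpr hab
  have hNr : (0 : ℝ) < N := by exact_mod_cast hN
  set s := √(b ^ 2 + a ^ 2) with hs
  have hs0 : 0 < s := by positivity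
  have hs2 : s ^ 2 = b ^ 2 + a ^ 2 := Real.sq_sqrt (by positivity)
  have hrpow : (b ^ 2 + a ^ 2) ^ ((N : ℝ) / 2) = s ^ N := by
    rw [hs, Real.sqrt_eq_rpow, ← Real.rpow_mul_natCast (by positivity)]
    ring_nf
  have hpow : (b - a) ^ ((N : ℝ) + 2) = (b - a) ^ (N + 2) := by
    exact_mod_cast Real.rpow_natCast (b - a) (N + 2)
  set q := √((N : ℝ) + 4) with hq
  have hq0 : 0 < q := by positivity
  have hsqrt : √(2 * (N : ℝ) / ((N : ℝ) + 4)) = √2 * √(N : ℝ) / q := by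
    rw [Real.sqrt_div (by positivity), Real.sqrt_mul (by norm_num)]
  have hbs : b ≤ s := Real.le_sqrt_of_sq_le (by nlinarith)
  have hkey : q * (a * b) ≤ s ^ 2 * ((a + b) / s) ^ (N + 2) := by
    refine le_of_sq_le_sq ?_ (by positivity)
    set r := a * b / s ^ 2 with hr
    have hr0 : 0 < r := by positivity
    have hr1 : r ≤ 1 / 2 := by
      rw [hr, div_le_iff₀ (by positivity), hs2]
      nlinarith [sq_nonneg (a - b)]
    have hab' : a * b = r * s ^ 2 := by rw [hr]; field_simp
    have hratio : ((a + b) / s) ^ 2 = 1 + 2 * r := by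
      rw [div_pow, div_eq_iff (by positivity), add_mul, mul_assoc 2, ← hab', one_mul, hs2]
      ring
    have hbern := one_add_mul_le_pow (a := 2 * r) (by linarith) (N + 2)
    push_cast at hbern
    have hq2 : q ^ 2 = N + 4 := Real.sq_sqrt (by positivity)
    have : (N + 4) * r ^ 2 ≤ (1 + 2 * r) ^ (N + 2) := by
      refine le_trans ?_ hbern
      nlinarith [mul_nonneg hr0.le (sub_nonneg.mpr hr1), mul_nonneg hNr.le
        (mul_nonneg hr0.le (sub_nonneg.mpr hr1)), mul_pos hNr hr0]
    calc (q * (a * b)) ^ 2 = ((N + 4) * r ^ 2) * s ^ 4 := by rw [mul_pow, hq2, hab']; ring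
      _ ≤ (1 + 2 * r) ^ (N + 2) * s ^ 4 := by gcongr
      _ = _ := by rw [← hratio, mul_pow, ← pow_mul, ← pow_mul, ← pow_mul]; ring_nf
  have hmain : q * (a * b) * b ≤ s ^ 2 * ((a + b) / s) ^ (N + 2) * s := by gcongr
  have hL : ((2 * b - 2 * a) / (2 * b + 2 * a)) ^ (N + 2) / (2 * a)
      = (b - a) ^ (N + 2) / (2 * (a + b) ^ (N + 2) * a ^ 2 * b ^ 2 * q) * (q * (a * b) * b) := by
    rw [← mul_sub, ← mul_add, mul_div_mul_left _ _ two_ne_zero, div_pow, add_comm b a]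
    field_simp
  rw [hL, hpow, hrpow, hsqrt]
  calc _ ≤ (b - a) ^ (N + 2) / (2 * (a + b) ^ (N + 2) * a ^ 2 * b ^ 2 * q) *
        (s ^ 2 * ((a + b) / s) ^ (N + 2) * s) := by gcongr
    _ = _ := by
      rw [div_pow]
      field_simp
      ring

open Kronecker in
/-- Decay of the inverse of a Kronecker sum in terms of the grid distance of the indices. -/
theorem abs_kroneckerSum_inv_apply_le {n : ℕ} {M : Matrix (Fin n) (Fin n) ℝ} (hM : M.IsHermitian)
    (htri : ∀ a c : Fin n, 1 < |(a : ℤ) - (c : ℤ)| → M a c = 0) {a b : ℝ} (ha : 0 < a)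
    (hmin : ∀ p, a ≤ hM.eigenvalues p) (hmax : ∀ p, hM.eigenvalues p ≤ b)
    (x y : Fin n × Fin n) :
    |(M ⊗ₖ (1 : Matrix (Fin n) (Fin n) ℝ) + (1 : Matrix (Fin n) (Fin n) ℝ) ⊗ₖ M)⁻¹ x y| ≤
      ((2 * b - 2 * a) / (2 * b + 2 * a)) ^
        (((x.1 : ℤ) - y.1).natAbs + ((x.2 : ℤ) - y.2).natAbs) / (2 * a) := by
  obtain ⟨U, hU, hMU⟩ := hM.exists_orthogonal_diagonalization
  have hT : (U ⊗ₖ U)ᵀ = Uᵀ ⊗ₖ Uᵀ := by ext; rfl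
  have hW : (U ⊗ₖ U) * (U ⊗ₖ U)ᵀ = 1 := by
    rw [hT, ← mul_kronecker_mul, hU, one_kronecker_one]
  have hS : M ⊗ₖ (1 : Matrix (Fin n) (Fin n) ℝ) + (1 : Matrix (Fin n) (Fin n) ℝ) ⊗ₖ M =
      (U ⊗ₖ U) * diagonal (fun p : Fin n × Fin n => hM.eigenvalues p.1 + hM.eigenvalues p.2) *
        (U ⊗ₖ U)ᵀ := by
    have hD : diagonal (fun p : Fin n × Fin n => hM.eigenvalues p.1 + hM.eigenvalues p.2) =
        diagonal hM.eigenvalues ⊗ₖ (1 : Matrix (Fin n) (Fin n) ℝ) +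
          (1 : Matrix (Fin n) (Fin n) ℝ) ⊗ₖ diagonal hM.eigenvalues := by
      rw [← diagonal_one, diagonal_kronecker_diagonal, diagonal_kronecker_diagonal, diagonal_add]
      simp
    rw [hD, Matrix.mul_add, Matrix.add_mul, hT]
    simp only [← mul_kronecker_mul, Matrix.mul_one, hU, ← hMU]
  refine abs_inv_apply_le_of_banded hW hS (by positivity)
    (fun p => by linarith [hmin p.1, hmin p.2]) (fun p => by linarith [hmax p.1, hmax p.2])
    (d := fun x y => ((x.1 : ℤ) - y.1).natAbs + ((x.2 : ℤ) - y.2).natAbs)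
    (by simp) (fun x y z => by omega) (fun x y hxy => ?_) x y
  rw [Matrix.add_apply, kronecker_apply, kronecker_apply]
  have h1 : M x.1 y.1 * (1 : Matrix (Fin n) (Fin n) ℝ) x.2 y.2 = 0 := by
    by_cases h : x.2 = y.2
    · rw [htri, zero_mul]
      rw [h] at hxy
      rw [Int.abs_eq_natAbs]
      omega
    · rw [one_apply_ne h, mul_zero]
  have h2 : (1 : Matrix (Fin n) (Fin n) ℝ) x.1 y.1 * M x.2 y.2 = 0 := by
    by_cases h : x.1 = y.1
    · rw [htri, mul_zero]
      rw [h] at hxy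
      rw [Int.abs_eq_natAbs]
      omega
    · rw [one_apply_ne h, zero_mul]
  rw [h1, h2, add_zero]

/-- Proposition 2.3 (i): explicit bound in terms of the index distance
`𝔫₂ = |ℓ-i| + |m-j| - 2` when both grid coordinates differ. -/
theorem kronSum_inv_entry_explicit_bound_offdiag
    (n : ℕ) (M : Matrix (Fin n) (Fin n) ℝ) (hM : M.PosDef)
    (htri : ∀ a c : Fin n, 1 < |(a : ℤ) - (c : ℤ)| → M a c = 0)
    (lammin lammax : ℝ)
    (hmin : IsLeast (Set.range hM.1.eigenvalues) lammin)
    (hmax : IsGreatest (Set.range hM.1.eigenvalues) lammax)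
    (hlt : lammin < lammax)
    (k t : ℕ) (hk1 : 1 ≤ k) (hk2 : k ≤ n * n) (ht1 : 1 ≤ t) (ht2 : t ≤ n * n)
    (i j ℓ m : ℕ)
    (hj : j = (t - 1) / n + 1) (hi : i = t - n * ((t - 1) / n))
    (hm : m = (k - 1) / n + 1) (hl : ℓ = k - n * ((k - 1) / n))
    (hne1 : ℓ ≠ i) (hne2 : m ≠ j)
    (𝔫 : ℝ) (h𝔫 : 𝔫 = |(ℓ : ℝ) - (i : ℝ)| + |(m : ℝ) - (j : ℝ)| - 2)
    (h𝔫pos : 0 < 𝔫) :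
    |(kronSum n M)⁻¹ ⟨k - 1, by omega⟩ ⟨t - 1, by omega⟩| ≤
      (1 / (2 * Real.sqrt 2)) *
        ((lammax - lammin) ^ (𝔫 + 2) / (lammax ^ 2 + lammin ^ 2) ^ (𝔫 / 2)) *
        (Real.sqrt (lammax ^ 2 + lammin ^ 2) / (lammax * lammin) ^ 2) *
        (1 / Real.sqrt 𝔫) * Real.sqrt (2 * 𝔫 / (𝔫 + 4)) := by
  obtain ⟨p₀, hp₀⟩ := hmin.1
  have ha : 0 < lammin := hp₀ ▸ hM.eigenvalues_pos p₀
  have hn : 0 < n := p₀.pos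
  have hlk : ℓ = (k - 1) % n + 1 := by
    have := Nat.div_add_mod (k - 1) n
    omega
  have hit : i = (t - 1) % n + 1 := by
    have := Nat.div_add_mod (t - 1) n
    omega
  obtain ⟨N, hN⟩ : ∃ N : ℕ, ((ℓ : ℤ) - i).natAbs + ((m : ℤ) - j).natAbs = N + 2 :=
    Nat.exists_eq_add_of_le' (by omega)
  have h𝔫N : 𝔫 = N := by
    have h := congrArg (Nat.cast : ℕ → ℝ) hN
    push_cast [Nat.cast_natAbs] at h
    rw [h𝔫]
    linarith
  subst h𝔫N
  refine le_trans ?_ (decay_le_explicit_bound ha hlt N (by exact_mod_cast h𝔫pos))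
  rw [kronSum_eq_submatrix, inv_submatrix_equiv, submatrix_apply]
  refine (abs_kroneckerSum_inv_apply_le hM.1 htri ha (fun p => hmin.2 ⟨p, rfl⟩)
    (fun p => hmax.2 ⟨p, rfl⟩) _ _).trans_eq ?_
  congr 2
  simp only [finProdFinEquiv_symm_apply, Fin.coe_divNat, Fin.coe_modNat]
  omega
end

section
/- Let S be an N×N real symmetric positive definite matrix that is b-banded (S_{ij} = 0 whenever |i − j| > b) with diagonal entries not greater than one, and let S = L Lᵀ be its Cholesky factorization (L lower triangular with positive diagonal). Let 𝔫 : {1,…,N} × {1,…,N} → ℝ and γ₀ > 0 be such that: (a) |(S⁻¹)_{k,r}| ≤ γ₀/√(𝔫(k,r)) for all k, r with 𝔫(k,r) > 0, and (b) 𝔫(k,t) ≤ 𝔫(k,r) whenever k ≤ t ≤ r ≤ t + b − 1. Then for all k, t with k ≤ t and 𝔫(k,t) > 0, the entries of the inverse transposed Cholesky factor satisfy |(L^{−T})_{k,t}| ≤ γ₀ · b/√(𝔫(k,t)). -/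
open Matrix

/-- The Cholesky factor of a banded matrix has the same lower bandwidth. -/
theorem cholesky_factor_banded {N b : ℕ} {S L : Matrix (Fin N) (Fin N) ℝ}
    (hband : ∀ a c : Fin N, (b : ℤ) < |(a : ℤ) - (c : ℤ)| → S a c = 0)
    (hLtri : ∀ a c : Fin N, (a : ℕ) < (c : ℕ) → L a c = 0)
    (hLdiag : ∀ a : Fin N, 0 < L a a) (hfact : S = L * Lᵀ)
    (r s : Fin N) (hrs : (s : ℕ) + b < r) : L r s = 0 := by
  induction hn : (s : ℕ) using Nat.strong_induction_on generalizing s with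
  | _ n ih =>
    have hS : S r s = 0 := by
      apply hband
      rw [abs_of_pos] <;> omega
    have hsum : S r s = L r s * L s s := by
      rw [hfact, Matrix.mul_apply, Finset.sum_eq_single s]
      · rfl
      · intro q _ hq
        rw [Matrix.transpose_apply]
        rcases lt_or_gt_of_ne (Fin.val_ne_of_ne hq) with h | h
        · rw [ih q (by omega) q (by omega) rfl, zero_mul]
        · rw [hLtri s q h, mul_zero]
      · simp
    rw [hS] at hsum
    exact (mul_eq_zero.mp hsum.symm).resolve_right (hLdiag s).ne'

/-- Each row entry `(L⁻ᵀ)_{k,t}`, `k ≤ t`, is bounded by the `ℓ¹` norm of the `b` entries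
`(S⁻¹)_{k,t}, …, (S⁻¹)_{k,t+b-1}`. -/
theorem abs_cholesky_inv_transpose_le_sum {N b : ℕ} (hb : 0 < b)
    {S L : Matrix (Fin N) (Fin N) ℝ} (hS : S.PosDef)
    (hdiag : ∀ a : Fin N, S a a ≤ 1)
    (hLtri : ∀ a c : Fin N, (a : ℕ) < (c : ℕ) → L a c = 0)
    (hLband : ∀ r s : Fin N, (s : ℕ) + b < r → L r s = 0)
    (hfact : S = L * Lᵀ) (k t : Fin N) (hkt : k ≤ t) :
    |(Lᵀ)⁻¹ k t| ≤
      ∑ r ∈ Finset.univ.filter (fun r : Fin N => t ≤ r ∧ (r : ℕ) < t + b), |S⁻¹ k r| := by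
  have hdet : IsUnit L.det := by
    have h := hS.det_pos
    rw [hfact, Matrix.det_mul, Matrix.det_transpose] at h
    exact isUnit_iff_ne_zero.mpr fun h0 => by simp [h0] at h
  have hdetT : IsUnit (Lᵀ).det := by rwa [Matrix.det_transpose]
  set x : Fin N → ℝ := fun s => (Lᵀ)⁻¹ k s with hx
  set u : Fin N → ℝ := fun r => S⁻¹ k r with hu
  have hxu (s : Fin N) : x s = ∑ r, u r * L r s := by
    have h : (Lᵀ)⁻¹ = S⁻¹ * L := by
      rw [hfact, Matrix.mul_inv_rev, Matrix.mul_assoc, Matrix.nonsing_inv_mul _ hdet,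
        Matrix.mul_one]
    simp only [hx, h, Matrix.mul_apply, hu]
  have hLx (r : Fin N) : ∑ s, L r s * x s = if k = r then 1 else 0 := by
    rw [← Matrix.one_apply, ← Matrix.nonsing_inv_mul _ hdetT, Matrix.mul_apply]
    exact Finset.sum_congr rfl fun s _ => mul_comm _ _
  set T : Finset (Fin N) := Finset.univ.filter (fun s => t ≤ s) with hT
  set W : Finset (Fin N) := Finset.univ.filter (fun r => t ≤ r ∧ (r : ℕ) < t + b) with hW
  set g : Fin N → ℝ := fun r => ∑ s ∈ T, L r s * x s with hg
  set X : ℝ := √(∑ s ∈ T, x s ^ 2) with hX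
  have hXsq : X ^ 2 = ∑ s ∈ T, x s ^ 2 := Real.sq_sqrt (Finset.sum_nonneg fun _ _ => sq_nonneg _)
  have hg0 (r : Fin N) (hr : r ∉ W) : g r = 0 := by
    have hr' : r < t ∨ (t : ℕ) + b ≤ r := by
      by_contra! h
      exact hr (by simp [hW, h])
    rcases hr' with h | h
    · refine Finset.sum_eq_zero fun s hs => ?_
      have : t ≤ s := by simpa [hT] using hs
      rw [hLtri r s (by omega), zero_mul]
    · have hne : k ≠ r := by
        rintro rfl
        omega
      rw [hg, ← (hLx r).trans (if_neg hne)]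
      refine Finset.sum_subset (Finset.subset_univ _) fun s _ hs => ?_
      have : s < t := by simpa [hT] using hs
      rw [hLband r s (by omega), zero_mul]
  have hgX (r : Fin N) : |g r| ≤ X := by
    refine Real.abs_le_sqrt ((Finset.sum_mul_sq_le_sq_mul_sq T (L r) x).trans ?_)
    refine mul_le_of_le_one_left (Finset.sum_nonneg fun _ _ => sq_nonneg _) ?_
    calc ∑ s ∈ T, L r s ^ 2 ≤ ∑ s, L r s ^ 2 :=
          Finset.sum_le_sum_of_subset_of_nonneg (Finset.subset_univ _) fun _ _ _ => sq_nonneg _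
      _ = S r r := by simp [hfact, Matrix.mul_apply, sq]
      _ ≤ 1 := hdiag r
  have hsum : X ^ 2 = ∑ r ∈ W, u r * g r := by
    rw [Finset.sum_subset (Finset.subset_univ W) fun r _ hr => by rw [hg0 r hr, mul_zero], hXsq]
    calc ∑ s ∈ T, x s ^ 2 = ∑ s ∈ T, ∑ r, u r * (L r s * x s) := by
          refine Finset.sum_congr rfl fun s _ => ?_
          rw [sq]
          nth_rewrite 1 [hxu s]
          rw [Finset.sum_mul]
          exact Finset.sum_congr rfl fun r _ => mul_assoc _ _ _
      _ = ∑ r, u r * g r := by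
          rw [Finset.sum_comm]
          exact Finset.sum_congr rfl fun r _ => (Finset.mul_sum _ _ _).symm
  have hle : X * X ≤ (∑ r ∈ W, |u r|) * X := by
    rw [← sq, hsum, Finset.sum_mul]
    refine Finset.sum_le_sum fun r _ => (le_abs_self _).trans ?_
    rw [abs_mul]
    exact mul_le_mul_of_nonneg_left (hgX r) (abs_nonneg _)
  have hxX : |x t| ≤ X :=
    Real.abs_le_sqrt (Finset.single_le_sum (f := fun s => x s ^ 2)
      (fun _ _ => sq_nonneg _) (by simp [hT]))
  refine hxX.trans ?_
  rcases (Real.sqrt_nonneg (∑ s ∈ T, x s ^ 2)).eq_or_lt with h | h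
  · rw [hX, ← h]
    exact Finset.sum_nonneg fun _ _ => abs_nonneg _
  · exact le_of_mul_le_mul_right hle h

/-- Decay bound for the inverse transposed Cholesky factor of a banded SPD
matrix with diagonal entries at most one: if `|S⁻¹_{k,r}| ≤ γ₀/√(𝔫 k r)` and
`𝔫` is monotone along each row within the band, then
`|(L⁻ᵀ)_{k,t}| ≤ γ₀ b / √(𝔫 k t)` for `k ≤ t`. Indices are 1-based. -/
theorem cholesky_inv_transpose_decay
    (N b : ℕ) (hb : 0 < b)
    (S L : Matrix (Fin N) (Fin N) ℝ) (hS : S.PosDef)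
    (hband : ∀ a c : Fin N, (b : ℤ) < |(a : ℤ) - (c : ℤ)| → S a c = 0)
    (hdiag : ∀ a : Fin N, S a a ≤ 1)
    (hLtri : ∀ a c : Fin N, (a : ℕ) < (c : ℕ) → L a c = 0)
    (hLdiag : ∀ a : Fin N, 0 < L a a)
    (hfact : S = L * Lᵀ)
    (𝔫 : ℕ → ℕ → ℝ) (γ₀ : ℝ) (hγ : 0 < γ₀)
    (ha : ∀ k r : ℕ, ∀ hk1 : 1 ≤ k, ∀ hk2 : k ≤ N, ∀ hr1 : 1 ≤ r, ∀ hr2 : r ≤ N,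
      0 < 𝔫 k r →
      |S⁻¹ ⟨k - 1, by omega⟩ ⟨r - 1, by omega⟩| ≤ γ₀ / Real.sqrt (𝔫 k r))
    (hmono : ∀ k t r : ℕ, k ≤ t → t ≤ r → r ≤ t + b - 1 → 𝔫 k t ≤ 𝔫 k r)
    (k t : ℕ) (hk1 : 1 ≤ k) (hk2 : k ≤ N) (ht1 : 1 ≤ t) (ht2 : t ≤ N)
    (hkt : k ≤ t) (h𝔫 : 0 < 𝔫 k t) :
    |(Lᵀ)⁻¹ ⟨k - 1, by omega⟩ ⟨t - 1, by omega⟩| ≤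
      γ₀ * b / Real.sqrt (𝔫 k t) := by
  refine (abs_cholesky_inv_transpose_le_sum hb hS hdiag hLtri
    (cholesky_factor_banded hband hLtri hLdiag hfact) hfact ⟨k - 1, by omega⟩ ⟨t - 1, by omega⟩
    (Fin.mk_le_mk.mpr (by omega))).trans ?_
  set W : Finset (Fin N) := Finset.univ.filter
    (fun r => (⟨t - 1, by omega⟩ : Fin N) ≤ r ∧ (r : ℕ) < t - 1 + b) with hW
  have hcard : W.card ≤ b := by
    calc W.card = (W.map Fin.valEmbedding).card := (Finset.card_map _).symm
      _ ≤ (Finset.Ico (t - 1) (t - 1 + b)).card := by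
          refine Finset.card_le_card fun m hm => ?_
          obtain ⟨r, hr, rfl⟩ := Finset.mem_map.mp hm
          simpa [hW, Fin.le_def] using hr
      _ = b := by simp
  have hterm : ∀ r ∈ W, |S⁻¹ ⟨k - 1, by omega⟩ r| ≤ γ₀ / √(𝔫 k t) := by
    intro r hr
    have hr' : t - 1 ≤ (r : ℕ) ∧ (r : ℕ) < t - 1 + b := by simpa [hW, Fin.le_def] using hr
    have hle : 𝔫 k t ≤ 𝔫 k (r + 1) := hmono k t (r + 1) hkt (by omega) (by omega)
    refine (ha k (r + 1) hk1 hk2 (by omega) (by omega) (h𝔫.trans_le hle)).trans ?_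
    exact div_le_div_of_nonneg_left hγ.le (Real.sqrt_pos.mpr h𝔫) (Real.sqrt_le_sqrt hle)
  refine (Finset.sum_le_card_nsmul W _ _ hterm).trans ?_
  rw [nsmul_eq_mul, mul_comm γ₀, mul_div_assoc]
  exact mul_le_mul_of_nonneg_right (by exact_mod_cast hcard) (by positivity)
end
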